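/- Let α∈(0,1) and θ∈ℝ with α+θ>0, let (K_n,(K_{r,n})_{r≥1}) be the Ewens–Pitman block-counting chain with parameters (α,θ), and fix an integer d≥1. Let M_n=(M_{1,n},…,M_{d,n})^T and let ⟨M⟩_n = ∑_{k=1}^{n−1} E[(M_{k+1}−M_k)(M_{k+1}−M_k)^T | F_k] be its predictable quadratic variation. Let V_n = n^{α/2}·diag(n^{−1},n^{−2},…,n^{−d}) and let Σ_d be the d×d matrix with entries Σ_{i,j} = ((−1)^{i+j}(i+j)!/(i!j!))·p_α(i+j)·Γ(α+θ−i+1)Γ(α+θ−j+1)/Γ(θ+1)². Then there exists a random variable S_{α,θ} with 0<S_{α,θ}<∞ almost surely such that K_n/n^α→S_{α,θ} almost surely and V_n⟨M⟩_nV_n → S_{α,θ}·Σ_d almost surely as n→∞. -/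

import Mathlib

open MeasureTheory ProbabilityTheory Filter Topology

noncomputable section

/-- Rising factorial `(a)^(m) = a (a+1) ⋯ (a+m-1)` of a real number. -/
def risingFactorial (a : ℝ) : ℕ → ℝ
  | 0 => 1
  | m + 1 => risingFactorial a m * (a + m)

/-- Sibuya probabilities `p_α(r) = α (1-α)^(r-1) / r!` for `r ≥ 1`. -/
def sibuya (α : ℝ) (r : ℕ) : ℝ :=
  α * risingFactorial (1 - α) (r - 1) / (Nat.factorial r : ℝ)

/-- The Ewens–Pitman block-counting chain with parameters `(α, θ)` on a probability space
`(Ω, μ)` with filtration `F`: for `n ≥ 1`, `K n` is the number of blocks and `B r n` the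
number of blocks of size `r` of the Ewens–Pitman random partition of `{1,…,n}`.
It starts from `K 1 = 1`, `B 1 1 = 1`, `B r 1 = 0` for `r ≥ 2`, and the transition from
time `n` to `n+1` creates a new block with conditional probability `(α K n + θ)/(n + θ)`,
and grows a block of size `r` to size `r+1` with conditional probability
`(r - α) B r n / (n + θ)`. -/
structure IsEwensPitman (α θ : ℝ) {Ω : Type*} {mΩ : MeasurableSpace Ω}
    (μ : Measure Ω) (F : Filtration ℕ mΩ) (K : ℕ → Ω → ℕ) (B : ℕ → ℕ → Ω → ℕ) :
    Prop where
  prob : IsProbabilityMeasure μ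
  meas_K : ∀ n, Measurable[F n] (K n)
  meas_B : ∀ r n, Measurable[F n] (B r n)
  init_K : ∀ᵐ ω ∂μ, K 1 ω = 1
  init_B1 : ∀ᵐ ω ∂μ, B 1 1 ω = 1
  init_B : ∀ r, 2 ≤ r → ∀ᵐ ω ∂μ, B r 1 ω = 0
  B_eq_zero : ∀ r n, n < r → ∀ᵐ ω ∂μ, B r n ω = 0
  sum_blocks : ∀ n, 1 ≤ n → ∀ᵐ ω ∂μ, K n ω = ∑ r ∈ Finset.Icc 1 n, B r n ω
  sum_sizes : ∀ n, 1 ≤ n → ∀ᵐ ω ∂μ, n = ∑ r ∈ Finset.Icc 1 n, r * B r n ω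
  trans_new : ∀ n, 1 ≤ n →
    μ[Set.indicator {ω | K (n+1) ω = K n ω + 1 ∧ B 1 (n+1) ω = B 1 n ω + 1 ∧
        ∀ s, 2 ≤ s → B s (n+1) ω = B s n ω} (fun _ => (1:ℝ)) | F n]
      =ᵐ[μ] fun ω => (α * (K n ω : ℝ) + θ) / ((n : ℝ) + θ)
  trans_grow : ∀ n, 1 ≤ n → ∀ r, 1 ≤ r →
    μ[Set.indicator {ω | K (n+1) ω = K n ω ∧ B r (n+1) ω + 1 = B r n ω ∧
        B (r+1) (n+1) ω = B (r+1) n ω + 1 ∧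
        ∀ s, 1 ≤ s → s ≠ r → s ≠ r + 1 → B s (n+1) ω = B s n ω} (fun _ => (1:ℝ)) | F n]
      =ᵐ[μ] fun ω => (((r : ℝ) - α) * (B r n ω : ℝ)) / ((n : ℝ) + θ)

/-- The coefficients `b_{r,i} = (-1)^(r-i) (i-α)^(r-i) / (r-i)!` for `1 ≤ i ≤ r`. -/
def bCoef (α : ℝ) (r i : ℕ) : ℝ :=
  (-1 : ℝ) ^ (r - i) * risingFactorial ((i : ℝ) - α) (r - i) / (Nat.factorial (r - i) : ℝ)

/-- `a_{r,n} = 1` for `n ≤ r` and `a_{r,n} = (θ+1)^(n-1)/(α+θ-r+1)^(n-1)` for `n ≥ r+1`. -/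
def aCoef (α θ : ℝ) (r n : ℕ) : ℝ :=
  if n ≤ r then 1
  else risingFactorial (θ + 1) (n - 1) / risingFactorial (α + θ - (r : ℝ) + 1) (n - 1)

/-- `S_{r,n} = ∑_{i=1}^r b_{r,i} K_{i,n} + (-1)^r p_α(r) K_n`. -/
def Sproc {Ω : Type*} (α : ℝ) (K : ℕ → Ω → ℕ) (B : ℕ → ℕ → Ω → ℕ) (r n : ℕ) (ω : Ω) : ℝ :=
  ∑ i ∈ Finset.Icc 1 r, bCoef α r i * (B i n ω : ℝ) + (-1 : ℝ) ^ r * sibuya α r * (K n ω : ℝ)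

/-- `M_{r,n} = a_{r,n} (S_{r,n} + (-1)^r p_α(r) θ / α)`. -/
def Mmart {Ω : Type*} (α θ : ℝ) (K : ℕ → Ω → ℕ) (B : ℕ → ℕ → Ω → ℕ) (r n : ℕ) (ω : Ω) : ℝ :=
  aCoef α θ r n * (Sproc α K B r n ω + (-1 : ℝ) ^ r * sibuya α r * θ / α)

/-- Entry `Σ_{i,j} = (-1)^(i+j) (i+j)!/(i!j!) p_α(i+j) Γ(α+θ-i+1)Γ(α+θ-j+1)/Γ(θ+1)²`. -/
def sigmaEntry (α θ : ℝ) (i j : ℕ) : ℝ :=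
  (-1 : ℝ) ^ (i + j) * (Nat.factorial (i + j) : ℝ) /
      ((Nat.factorial i : ℝ) * (Nat.factorial j : ℝ)) * sibuya α (i + j) *
    (Real.Gamma (α + θ - (i : ℝ) + 1) * Real.Gamma (α + θ - (j : ℝ) + 1) /
      Real.Gamma (θ + 1) ^ 2)


lemma rf_eq_prod (a : ℝ) (n : ℕ) : risingFactorial a n = ∏ j ∈ Finset.range n, (a + j) := by
  induction n with
  | zero => simp [risingFactorial]
  | succ n ih => rw [Finset.prod_range_succ, ← ih, risingFactorial]

lemma rf_pos {a : ℝ} (ha : 0 < a) (n : ℕ) : 0 < risingFactorial a n := by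
  rw [rf_eq_prod]; exact Finset.prod_pos fun i _ => by positivity

lemma rf_add (a : ℝ) (m n : ℕ) :
    risingFactorial a (m + n) = risingFactorial a m * risingFactorial (a + m) n := by
  induction n with
  | zero => simp [risingFactorial]
  | succ n ih => rw [← add_assoc, risingFactorial, ih, risingFactorial]; push_cast; ring

lemma rf_succ' (a : ℝ) (n : ℕ) :
    risingFactorial a (n + 1) = a * risingFactorial (a + 1) n := by
  rw [add_comm, rf_add]; simp [risingFactorial]

lemma tendsto_shift_ratio (x y : ℝ) :
    Tendsto (fun n : ℕ => (x + n) / (y + n)) atTop (𝓝 1) := by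
  have h1 : Tendsto (fun n : ℕ => (x - y) / (y + n)) atTop (𝓝 0) :=
    tendsto_const_nhds.div_atTop (tendsto_atTop_add_const_left _ _ tendsto_natCast_atTop_atTop)
  have h2 : ∀ᶠ n : ℕ in atTop, 0 < y + (n : ℝ) :=
    (tendsto_atTop_add_const_left _ y tendsto_natCast_atTop_atTop).eventually_gt_atTop 0
  have h3 := h1.add_const 1
  rw [zero_add] at h3
  refine h3.congr' ?_
  filter_upwards [h2] with n hn
  field_simp
  ring

lemma ev_pos (y : ℝ) : ∀ᶠ n : ℕ in atTop, 0 < y + (n : ℝ) :=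
  (tendsto_atTop_add_const_left _ y tendsto_natCast_atTop_atTop).eventually_gt_atTop 0

lemma rf_ratio (x y : ℝ) (hy : 0 < y) :
    Tendsto (fun n : ℕ => risingFactorial y n / risingFactorial x n * (n : ℝ) ^ (x - y)) atTop
      (𝓝 (Real.Gamma x / Real.Gamma y)) := by
  have h := ((Real.GammaSeq_tendsto_Gamma x).div (Real.GammaSeq_tendsto_Gamma y)
    (Real.Gamma_pos_of_pos hy).ne').mul (tendsto_shift_ratio x y)
  rw [mul_one] at h
  refine h.congr' ?_
  filter_upwards [ev_pos x, ev_pos y, eventually_gt_atTop 0] with n hx hy' hn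
  have hn' : (0:ℝ) < n := by exact_mod_cast hn
  simp only [Pi.div_apply]
  unfold Real.GammaSeq
  rw [← rf_eq_prod, ← rf_eq_prod, risingFactorial, risingFactorial, Real.rpow_sub hn']
  have h1 := (Real.rpow_pos_of_pos hn' x).ne'
  have h2 := (Real.rpow_pos_of_pos hn' y).ne'
  have h3 := (rf_pos hy n).ne'
  have h4 : (Nat.factorial n : ℝ) ≠ 0 := by positivity
  by_cases h0 : risingFactorial x n = 0
  · simp [h0]
  field_simp

lemma rf_ratio' (x y : ℝ) (hy : 0 < y) :
    Tendsto (fun n : ℕ => risingFactorial y (n - 1) / risingFactorial x (n - 1) * (n : ℝ) ^ (x - y))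
      atTop (𝓝 (Real.Gamma x / Real.Gamma y)) := by
  have h := (rf_ratio x y hy).mul (tendsto_shift_ratio (x - 1) (y - 1))
  rw [mul_one] at h
  refine h.congr' ?_
  filter_upwards [ev_pos (x-1), ev_pos (y-1), eventually_gt_atTop 0] with n hx hy' hn
  obtain ⟨m, rfl⟩ : ∃ m, n = m + 1 := ⟨n - 1, by omega⟩
  simp only [Nat.add_sub_cancel, risingFactorial]
  push_cast at hx hy' ⊢
  have h3 := (rf_pos hy m).ne'
  by_cases h0 : risingFactorial x m = 0
  · simp [h0]
  have e1 : x - 1 + (m + 1 : ℝ) = x + m := by ring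
  have e2 : y - 1 + (m + 1 : ℝ) = y + m := by ring
  rw [e1] at hx ⊢
  rw [e2] at hy' ⊢
  field_simp

/-- Robbins–Monro type deterministic lemma. -/
lemma detA (y a ε δ : ℕ → ℝ) (L c T : ℝ) (hc : 0 < c)
    (h : ∀ᶠ n in atTop, y (n+1) = (1 - a n) * y n + a n * ε n + δ n)
    (ha : ∀ᶠ n : ℕ in atTop, c / ((n:ℝ) + 1) ≤ a n ∧ a n ≤ 1)
    (hε : Tendsto ε atTop (𝓝 L))
    (hδ : Tendsto (fun n => ∑ k ∈ Finset.range n, δ k) atTop (𝓝 T)) :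
    Tendsto y atTop (𝓝 L) := by
  set t : ℕ → ℝ := fun n => T - ∑ k ∈ Finset.range n, δ k with ht
  have ht0 : Tendsto t atTop (𝓝 0) := by simpa using hδ.const_sub T
  set z : ℕ → ℝ := fun n => y n + t n with hz
  have hzrec : ∀ᶠ n in atTop, z (n+1) = (1 - a n) * z n + a n * (ε n + t n) := by
    filter_upwards [h] with n hn
    simp only [hz, hn, ht, Finset.sum_range_succ]; ring
  have hε' : Tendsto (fun n => ε n + t n) atTop (𝓝 L) := by simpa using hε.add ht0
  suffices hzL : Tendsto z atTop (𝓝 L) by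
    have := hzL.sub ht0
    simpa [hz] using this
  set H : ℕ → ℝ := fun n => ∑ i ∈ Finset.range n, 1 / ((i:ℝ) + 1) with hH
  have hHt : Tendsto H atTop atTop := Real.tendsto_sum_range_one_div_nat_succ_atTop
  rw [Metric.tendsto_atTop]
  intro e he
  have hev : ∀ᶠ n in atTop, |ε n + t n - L| ≤ e / 2 := by
    have := (Metric.tendsto_nhds.1 hε' (e/2) (by linarith))
    filter_upwards [this] with n hn
    rw [Real.dist_eq] at hn; exact hn.le
  obtain ⟨N, hN⟩ := eventually_atTop.1 (hzrec.and (ha.and hev))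
  set W := |z N - L| with hW
  have key : ∀ n, N ≤ n → |z n - L| - e/2 ≤ W * Real.exp (c * H N) * Real.exp (- (c * H n)) := by
    intro n hn
    induction n, hn using Nat.le_induction with
    | base =>
      rw [mul_assoc, ← Real.exp_add]; simp; linarith
    | succ n hn ih =>
      obtain ⟨h1, ⟨h2, h3⟩, h4⟩ := hN n hn
      have hpos : 0 < c / ((n:ℝ)+1) := by positivity
      have e1 : z (n+1) - L = (1 - a n) * (z n - L) + a n * (ε n + t n - L) := by rw [h1]; ring
      have e2 : |z (n+1) - L| ≤ (1 - a n) * |z n - L| + a n * (e/2) := by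
        rw [e1]
        refine (abs_add_le _ _).trans ?_
        rw [abs_mul, abs_mul, abs_of_nonneg (by linarith : 0 ≤ 1 - a n),
          abs_of_nonneg (by linarith : 0 ≤ a n)]
        gcongr
        linarith
      set X := W * Real.exp (c * H N) * Real.exp (- (c * H n)) with hX
      have hX0 : 0 ≤ X := by positivity
      have e3 : H (n+1) = H n + 1 / ((n:ℝ)+1) := by simp [hH, Finset.sum_range_succ]
      have e4 : W * Real.exp (c * H N) * Real.exp (- (c * H (n+1)))
          = X * Real.exp (- (c / ((n:ℝ)+1))) := by
        rw [e3, hX, mul_assoc _ (Real.exp (- (c * H n))), ← Real.exp_add]; ring_nf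
      rw [e4]
      have e5 : 1 - c / ((n:ℝ)+1) ≤ Real.exp (- (c / ((n:ℝ)+1))) := by
        have := Real.add_one_le_exp (- (c / ((n:ℝ)+1))); linarith
      calc |z (n+1) - L| - e/2 ≤ (1 - a n) * (|z n - L| - e/2) := by linarith
        _ ≤ (1 - a n) * X := by apply mul_le_mul_of_nonneg_left ih; linarith
        _ ≤ Real.exp (- (c / ((n:ℝ)+1))) * X := by
            apply mul_le_mul_of_nonneg_right _ hX0; linarith
        _ = _ := mul_comm _ _
  have hlim : Tendsto (fun n => W * Real.exp (c * H N) * Real.exp (- (c * H n))) atTop (𝓝 0) := by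
    have : Tendsto (fun n => Real.exp (- (c * H n))) atTop (𝓝 0) :=
      Real.tendsto_exp_atBot.comp (tendsto_neg_atTop_atBot.comp (hHt.const_mul_atTop hc))
    simpa using this.const_mul (W * Real.exp (c * H N))
  obtain ⟨N2, hN2⟩ := eventually_atTop.1 (hlim.eventually (gt_mem_nhds (by linarith : (0:ℝ) < e/2)))
  refine ⟨max N N2, fun n hn => ?_⟩
  rw [Real.dist_eq]
  have := key n (le_trans (le_max_left _ _) hn)
  have := hN2 n (le_trans (le_max_right _ _) hn)
  linarith

/-- bounds for a = p/(n+s) -/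
lemma a_bounds (p s : ℝ) (hp : 0 < p) :
    ∀ᶠ n : ℕ in atTop, (p/2) / ((n:ℝ)+1) ≤ p / (s + n) ∧ p / (s + n) ≤ 1 := by
  filter_upwards [ev_pos s, ev_pos (s - p), ev_pos (2 - s)] with n h1 h2 h3
  constructor
  · rw [div_div]
    apply div_le_div_of_nonneg_left hp.le h1
    linarith
  · rw [div_le_one h1]; linarith

lemma sum_asymp (t : ℕ → ℝ) (p L : ℝ) (hp : 0 < p)
    (ht : Tendsto (fun n : ℕ => t n * (n:ℝ) ^ (1 - p)) atTop (𝓝 L)) :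
    Tendsto (fun n : ℕ => (n:ℝ) ^ (-p) * ∑ k ∈ Finset.Icc 1 (n-1), t k) atTop (𝓝 (L / p)) := by
  set h : ℕ → ℝ := fun n => risingFactorial (p+1) (n-1) / risingFactorial 1 (n-1) with hh
  have hpos : ∀ n, 0 < h n := fun n => div_pos (rf_pos (by linarith) _) (rf_pos one_pos _)
  have hlim : Tendsto (fun n : ℕ => h n * (n:ℝ) ^ (-p)) atTop (𝓝 (1 / Real.Gamma (p+1))) := by
    have := rf_ratio' 1 (p+1) (by linarith)
    simpa [hh] using this
  have hG : 0 < Real.Gamma (p+1) := Real.Gamma_pos_of_pos (by linarith)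
  have hrec : ∀ n, 1 ≤ n → h (n+1) = h n * ((p + n) / n) := by
    intro n hn
    obtain ⟨m, rfl⟩ : ∃ m, n = m + 1 := ⟨n - 1, by omega⟩
    simp only [hh, Nat.add_sub_cancel, risingFactorial]
    rw [mul_div_mul_comm]; push_cast; congr 2 <;> ring
  have hy : Tendsto (fun n => (∑ k ∈ Finset.Icc 1 (n-1), t k) / h n) atTop
      (𝓝 (L * Real.Gamma (p+1) / p)) := by
    refine detA _ (fun n => p / (p + n)) (fun n => t n * n / (p * h n)) (fun _ => 0) _ (p/2) 0
      (by linarith) ?_ (a_bounds p p hp) ?_ (by simp)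
    · filter_upwards [eventually_ge_atTop 1] with n hn
      obtain ⟨m, rfl⟩ : ∃ m, n = m + 1 := ⟨n - 1, by omega⟩
      have hq := hpos (m+1)
      have : (0:ℝ) < p + (m+1 : ℕ) := by positivity
      have hm : (0:ℝ) < (m+1 : ℕ) := by positivity
      rw [hrec _ hn]
      simp only [Nat.add_sub_cancel]
      rw [Finset.sum_Icc_succ_top (by omega)]
      field_simp
      ring
    · have := (ht.div hlim (by positivity)).div_const p
      refine (this.congr' ?_).trans (by rw [show L / (1 / Real.Gamma (p+1)) / p = L * Real.Gamma (p+1) / p by field_simp])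
      filter_upwards [eventually_ge_atTop 1] with n hn
      have hn' : (0:ℝ) < n := by exact_mod_cast hn
      have hq := hpos n
      simp only [Pi.div_apply]
      rw [sub_eq_add_neg, Real.rpow_add hn', Real.rpow_one]
      have := Real.rpow_pos_of_pos hn' (-p)
      field_simp
  have := hy.mul hlim
  rw [show L * Real.Gamma (p+1) / p * (1 / Real.Gamma (p+1)) = L / p by field_simp] at this
  refine this.congr fun n => ?_
  have hq := hpos n
  field_simp


def bbc (α : ℝ) (i r : ℕ) : ℝ := if r ≤ i then bCoef α i r else 0

def ucf (α : ℝ) (i r : ℕ) : ℝ := bbc α i (r+1) - bbc α i r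

def wcf (α : ℝ) (r : ℕ) : ℝ := α * risingFactorial (1 - α) r / (Nat.factorial r : ℝ)

lemma bbc_zero (α : ℝ) (i : ℕ) (hi : 1 ≤ i) : bbc α i 0 = - ((-1) ^ i * sibuya α i) := by
  obtain ⟨m, rfl⟩ : ∃ m, i = m + 1 := ⟨i - 1, by omega⟩
  simp only [bbc, bCoef, sibuya, zero_le, if_true, Nat.sub_zero, Nat.add_sub_cancel, Nat.cast_zero,
    zero_sub, rf_succ']
  rw [show -α + 1 = 1 - α by ring]; ring

lemma ucf_zero (α : ℝ) (i r : ℕ) (h : i < r) : ucf α i r = 0 := by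
  simp [ucf, bbc, show ¬ r ≤ i by omega, show ¬ r + 1 ≤ i by omega]

lemma ucf_eq (α : ℝ) (i r : ℕ) (h : r ≤ i) : ucf α i r =
    - ((-1) ^ (i - r) * risingFactorial (1 - α + r) (i - r) / (Nat.factorial (i - r) : ℝ)) := by
  obtain ⟨m, rfl⟩ : ∃ m, i = r + m := ⟨i - r, by omega⟩
  rcases m with _ | m
  · simp [ucf, bbc, bCoef, risingFactorial]
  · simp only [ucf, bbc, bCoef, show r + 1 ≤ r + (m+1) by omega, show r ≤ r + (m+1) by omega, if_true,
      show r + (m+1) - (r+1) = m by omega, show r + (m+1) - r = m + 1 by omega]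
    rw [rf_succ', show risingFactorial (1 - α + r) (m+1) = risingFactorial (1 - α + r) m * (1 - α + r + m) from rfl]
    push_cast [Nat.factorial_succ]
    rw [show (r:ℝ) + 1 - α = 1 - α + r by ring, show (r:ℝ) - α + 1 = 1 - α + r by ring]
    have : (Nat.factorial m : ℝ) ≠ 0 := by positivity
    field_simp
    ring

lemma vdm (i : ℕ) : ∀ (β : ℝ) (j : ℕ), ∑ r ∈ Finset.range (j+1), (Nat.choose i r : ℝ) *
    (risingFactorial (β + r) (j - r) / (Nat.factorial (j - r) : ℝ))
    = risingFactorial (β + i) j / (Nat.factorial j : ℝ) := by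
  induction i with
  | zero =>
    intro β j
    rw [Finset.sum_range_succ']
    simp
  | succ i ih =>
    intro β j
    rcases j with _ | j
    · simp [risingFactorial]
    · have h1 := ih β (j+1)
      have h2 := ih (β+1) j
      rw [Finset.sum_range_succ'] at h1 ⊢
      have : ∀ r ∈ Finset.range (j+1), (Nat.choose (i+1) (r+1) : ℝ) *
          (risingFactorial (β + (r+1 : ℕ)) (j + 1 - (r+1)) / (Nat.factorial (j + 1 - (r+1)) : ℝ))
          = (Nat.choose i r : ℝ) * (risingFactorial (β + 1 + r) (j - r) / (Nat.factorial (j - r) : ℝ))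
          + (Nat.choose i (r+1) : ℝ) *
          (risingFactorial (β + (r+1 : ℕ)) (j + 1 - (r+1)) / (Nat.factorial (j + 1 - (r+1)) : ℝ)) := by
        intro r _
        rw [Nat.choose_succ_succ]
        simp only [Nat.add_sub_add_right]
        push_cast
        rw [show β + (r + 1 : ℝ) = β + 1 + r by ring]; ring
      rw [Finset.sum_congr rfl this, Finset.sum_add_distrib, h2]
      simp only [Nat.choose_zero_right] at h1 ⊢
      rw [add_assoc, h1, rf_succ', show β + ((i+1 : ℕ):ℝ) = β + 1 + i by push_cast; ring,
        show β + (i:ℝ) + 1 = β + 1 + i by ring, risingFactorial]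
      push_cast [Nat.factorial_succ]
      have : (Nat.factorial j : ℝ) ≠ 0 := by positivity
      field_simp
      ring

lemma uuw (α : ℝ) (i j : ℕ) (hi : 1 ≤ i) (N : ℕ) (hN : j + 1 ≤ N) :
    ∑ r ∈ Finset.range N, ucf α i r * ucf α j r * wcf α r =
    ((i + j : ℕ) - α) * ((-1 : ℝ) ^ (i + j) * (Nat.factorial (i + j) : ℝ) /
      ((Nat.factorial i : ℝ) * (Nat.factorial j : ℝ)) * sibuya α (i + j)) := by
  have h0 : ∑ r ∈ Finset.range (j+1), ucf α i r * ucf α j r * wcf α r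
     = ∑ r ∈ Finset.range N, ucf α i r * ucf α j r * wcf α r := by
    apply Finset.sum_subset
    · intro x; simp; omega
    · intro x _ hx
      simp at hx
      rw [ucf_zero α j x (by omega)]; ring
  rw [← h0]
  have h1 : ∀ r ∈ Finset.range (j+1), ucf α i r * ucf α j r * wcf α r =
      ((-1) ^ (i+j) * α * risingFactorial (1-α) i / (Nat.factorial i : ℝ)) *
      ((Nat.choose i r : ℝ) *
    (risingFactorial (1 - α + r) (j - r) / (Nat.factorial (j - r) : ℝ))) := by
    intro r hr
    simp at hr
    by_cases h : r ≤ i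
    · rw [ucf_eq α i r h, ucf_eq α j r (by omega), wcf, Nat.cast_choose ℝ h]
      have e1 : risingFactorial (1-α) i = risingFactorial (1-α) r * risingFactorial (1 - α + r) (i - r) := by
        rw [← rf_add]; congr 1; omega
      have e2 : (-1:ℝ) ^ (i+j) = (-1) ^ (i-r) * (-1) ^ (j-r) := by
        rw [← pow_add, show i + j = (i - r + (j-r)) + 2 * r by omega, pow_add, pow_mul]; simp
      rw [e1, e2]
      field_simp
    · rw [ucf_zero α i r (by omega), Nat.choose_eq_zero_of_lt (by omega)]; simp
  rw [Finset.sum_congr rfl h1, ← Finset.mul_sum, vdm]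
  obtain ⟨m, hm⟩ : ∃ m, i + j = m + 1 := ⟨i + j - 1, by omega⟩
  have e3 : risingFactorial (1-α) (i+j) = risingFactorial (1-α) i * risingFactorial (1 - α + i) j := rf_add _ _ _
  have e4 : risingFactorial (1-α) (i+j) = risingFactorial (1-α) (i+j-1) * ((i+j : ℕ) - α) := by
    rw [hm]; simp only [risingFactorial, Nat.add_sub_cancel]; push_cast; ring
  rw [sibuya]
  have e5 : risingFactorial (1-α) i * risingFactorial (1 - α + i) j = risingFactorial (1-α) (i+j-1) * ((i+j : ℕ) - α) := by rw [← e3, e4]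
  have : (Nat.factorial (i+j) : ℝ) ≠ 0 := by positivity
  field_simp
  linear_combination α * e5

lemma wcf_succ (α : ℝ) (r : ℕ) : wcf α (r+1) = (((r+1:ℕ):ℝ) - α) * sibuya α (r+1) := by
  simp only [wcf, sibuya, Nat.add_sub_cancel, risingFactorial]; push_cast; ring

lemma wcf_sib (α : ℝ) (r : ℕ) : wcf α r = ((r+1:ℕ):ℝ) * sibuya α (r+1) := by
  simp only [wcf, sibuya, Nat.add_sub_cancel]; push_cast [Nat.factorial_succ]
  field_simp


lemma mart_conv {Ω : Type*} {mΩ : MeasurableSpace Ω} {μ : Measure Ω} [IsProbabilityMeasure μ]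
    (G : Filtration ℕ mΩ) (f : ℕ → Ω → ℝ) (ad : ∀ n, StronglyMeasurable[G n] (f n))
    (int : ∀ n, Integrable (f n) μ) (hc : ∀ n, μ[f (n+1) | G n] =ᵐ[μ] f n) (R : ℝ)
    (hR : ∀ n, ∫ ω, |f n ω| ∂μ ≤ R) :
    ∀ᵐ ω ∂μ, ∃ l, Tendsto (fun n => f n ω) atTop (𝓝 l) := by
  have hm : Martingale f G μ := martingale_nat ad int fun n => (hc n).symm
  refine hm.submartingale.exists_ae_tendsto_of_bdd (R := R.toNNReal) ?_
  intro n
  have h1 := (int n)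
  rw [eLpNorm_one_eq_lintegral_enorm, ← ofReal_integral_norm_eq_lintegral_enorm h1]
  exact ENNReal.ofReal_le_ofReal (hR n)

lemma L2conv {Ω : Type*} {mΩ : MeasurableSpace Ω} {μ : Measure Ω} [IsProbabilityMeasure μ]
    (G : Filtration ℕ mΩ) (ξ : ℕ → Ω → ℝ) (ad : ∀ n, StronglyMeasurable[G (n+1)] (ξ n))
    (C : ℕ → ℝ) (hC : ∀ n, ∀ᵐ ω ∂μ, |ξ n ω| ≤ C n)
    (hc : ∀ n, μ[ξ n | G n] =ᵐ[μ] 0) (v : ℕ → ℝ) (hv : ∀ n, ∫ ω, (ξ n ω)^2 ∂μ ≤ v n) (R : ℝ)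
    (hR : ∀ n, ∑ k ∈ Finset.range n, v k ≤ R) :
    ∀ᵐ ω ∂μ, ∃ l, Tendsto (fun n => ∑ k ∈ Finset.range n, ξ k ω) atTop (𝓝 l) := by
  set T : ℕ → Ω → ℝ := fun n ω => ∑ k ∈ Finset.range n, ξ k ω with hT
  have hTs : ∀ n, T (n+1) = T n + ξ n := by
    intro n; funext ω; simp [hT, Finset.sum_range_succ]
  have adT : ∀ n, StronglyMeasurable[G n] (T n) := by
    intro n
    induction n with
    | zero => simp only [hT, Finset.range_zero, Finset.sum_empty]; exact stronglyMeasurable_const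
    | succ n ih => rw [hTs]; exact (ih.mono (G.mono (Nat.le_succ n))).add (ad n)
  have bdT : ∀ n, ∀ᵐ ω ∂μ, |T n ω| ≤ ∑ k ∈ Finset.range n, C k := by
    intro n
    filter_upwards [ae_all_iff.2 hC] with ω hω
    exact (Finset.abs_sum_le_sum_abs _ _).trans (Finset.sum_le_sum fun k _ => hω k)
  have mξ : ∀ n, AEStronglyMeasurable (ξ n) μ := fun n => ((ad n).mono (G.le _)).aestronglyMeasurable
  have mT : ∀ n, AEStronglyMeasurable (T n) μ := fun n => ((adT n).mono (G.le _)).aestronglyMeasurable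
  have iξ : ∀ n, Integrable (ξ n) μ := fun n => Integrable.of_bound (mξ n) (C n) (hC n)
  have iT : ∀ n, Integrable (T n) μ := fun n => Integrable.of_bound (mT n) _ (bdT n)
  have iTξ : ∀ n, Integrable (T n * ξ n) μ := fun n => (iξ n).bdd_mul (mT n) (bdT n)
  have iTT : ∀ n, Integrable (T n * T n) μ := fun n => (iT n).bdd_mul (mT n) (bdT n)
  have iξξ : ∀ n, Integrable (ξ n * ξ n) μ := fun n => (iξ n).bdd_mul (mξ n) (hC n)
  have hsq : ∀ n, ∫ ω, (T n * T n) ω ∂μ ≤ ∑ k ∈ Finset.range n, v k := by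
    intro n
    induction n with
    | zero => simp [hT]
    | succ n ih =>
      have e0 : ∫ ω, (T n * ξ n) ω ∂μ = 0 := by
        rw [← integral_condExp (G.le n)]
        rw [integral_congr_ae ((condExp_mul_of_stronglyMeasurable_left (adT n) (iTξ n) (iξ n)).trans
          (EventuallyEq.mul EventuallyEq.rfl (hc n)))]
        simp
      have e1 : T (n+1) * T (n+1) = T n * T n + (2:ℝ) • (T n * ξ n) + ξ n * ξ n := by
        rw [hTs]; funext ω; simp; ring
      rw [e1, integral_add' ((iTT n).add ((iTξ n).smul 2)) (iξξ n),
        integral_add' (iTT n) ((iTξ n).smul 2)]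
      have e2 : ∫ ω, ((2:ℝ) • (T n * ξ n)) ω ∂μ = 0 := by
        simp only [Pi.smul_apply]; rw [integral_smul, e0, smul_zero]
      rw [e2, Finset.sum_range_succ]
      have e3 := hv n
      simp only [sq] at e3
      simp only [Pi.mul_apply] at ih ⊢
      linarith
  refine mart_conv G T adT iT ?_ (1 + R) ?_
  · intro n
    rw [hTs]
    refine (condExp_add (iT n) (iξ n) _).trans ?_
    rw [condExp_of_stronglyMeasurable (G.le n) (adT n) (iT n)]
    filter_upwards [hc n] with ω hω
    simp [hω]
  · intro n
    calc ∫ ω, |T n ω| ∂μ ≤ ∫ ω, (1 + (T n * T n) ω) ∂μ := by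
          apply integral_mono (iT n).abs ((integrable_const 1).add (iTT n))
          intro ω
          change |T n ω| ≤ 1 + T n ω * T n ω
          rcases abs_cases (T n ω) with h | h <;> nlinarith [sq_nonneg (|T n ω| - 1), sq_abs (T n ω)]
      _ = 1 + ∫ ω, (T n * T n) ω ∂μ := by
          rw [integral_add (integrable_const 1) (iTT n)]; simp
      _ ≤ 1 + R := by have := hsq n; have := hR n; linarith

def shiftF {Ω : Type*} {mΩ : MeasurableSpace Ω} (F : Filtration ℕ mΩ) : Filtration ℕ mΩ where
  seq n := F (n+1)
  mono' := fun _ _ h => F.mono (Nat.succ_le_succ h)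
  le' n := F.le (n+1)

def evS {Ω : Type*} (K : ℕ → Ω → ℕ) (B : ℕ → ℕ → Ω → ℕ) : ℕ → ℕ → Set Ω
  | 0, n => {ω | K (n+1) ω = K n ω + 1 ∧ B 1 (n+1) ω = B 1 n ω + 1 ∧
        ∀ s, 2 ≤ s → B s (n+1) ω = B s n ω}
  | r+1, n => {ω | K (n+1) ω = K n ω ∧ B (r+1) (n+1) ω + 1 = B (r+1) n ω ∧
        B ((r+1)+1) (n+1) ω = B ((r+1)+1) n ω + 1 ∧
        ∀ s, 1 ≤ s → s ≠ r+1 → s ≠ (r+1) + 1 → B s (n+1) ω = B s n ω}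

def ee {Ω : Type*} (K : ℕ → Ω → ℕ) (B : ℕ → ℕ → Ω → ℕ) (r n : ℕ) : Ω → ℝ :=
  (evS K B r n).indicator fun _ => (1:ℝ)

def pp {Ω : Type*} (α θ : ℝ) (K : ℕ → Ω → ℕ) (B : ℕ → ℕ → Ω → ℕ) : ℕ → ℕ → Ω → ℝ
  | 0, n => fun ω => (α * (K n ω : ℝ) + θ) / ((n : ℝ) + θ)
  | r+1, n => fun ω => ((((r+1 : ℕ) : ℝ) - α) * (B (r+1) n ω : ℝ)) / ((n : ℝ) + θ)

section
variable {α θ : ℝ} {Ω : Type*} {mΩ : MeasurableSpace Ω}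
    {μ : Measure Ω} {F : Filtration ℕ mΩ} {K : ℕ → Ω → ℕ} {B : ℕ → ℕ → Ω → ℕ}

lemma measSet_eq {m : MeasurableSpace Ω} {f g : Ω → ℕ} (hf : Measurable[m] f) (hg : Measurable[m] g) :
    MeasurableSet[m] {ω | f ω = g ω} := measurableSet_eq_fun hf hg

lemma evS_meas (hEP : IsEwensPitman α θ μ F K B) (r n : ℕ) : MeasurableSet[F (n+1)] (evS K B r n) := by
  have hK : Measurable[F (n+1)] (K n) := (hEP.meas_K n).mono (F.mono (Nat.le_succ n)) le_rfl
  have hB : ∀ s, Measurable[F (n+1)] (B s n) :=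
    fun s => (hEP.meas_B s n).mono (F.mono (Nat.le_succ n)) le_rfl
  have hK' := hEP.meas_K (n+1)
  have hB' := fun s => hEP.meas_B s (n+1)
  have c1 : ∀ {f : Ω → ℕ}, Measurable[F (n+1)] f → Measurable[F (n+1)] (fun ω => f ω + 1) :=
    fun hf => (measurable_from_top (f := fun k : ℕ => k + 1)).comp hf
  rcases r with _ | r
  · refine (measSet_eq hK' (c1 hK)).inter ((measSet_eq (hB' 1) (c1 (hB 1))).inter ?_)
    have : MeasurableSet[F (n+1)] (⋂ s, ⋂ (_ : 2 ≤ s), {ω | B s (n+1) ω = B s n ω}) :=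
      MeasurableSet.iInter fun s => MeasurableSet.iInter fun _ => measSet_eq (hB' s) (hB s)
    have e : {ω | ∀ s, 2 ≤ s → B s (n+1) ω = B s n ω} =
        (⋂ s, ⋂ (_ : 2 ≤ s), {ω | B s (n+1) ω = B s n ω}) := by ext; simp
    rw [← e] at this
    exact this
  · refine (measSet_eq hK' hK).inter ((measSet_eq (c1 (hB' _)) (hB _)).inter
      ((measSet_eq (hB' _) (c1 (hB _))).inter ?_))
    have : MeasurableSet[F (n+1)] (⋂ s, ⋂ (_ : 1 ≤ s), ⋂ (_ : s ≠ r+1), ⋂ (_ : s ≠ (r+1)+1),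
        {ω | B s (n+1) ω = B s n ω}) :=
      MeasurableSet.iInter fun s => MeasurableSet.iInter fun _ => MeasurableSet.iInter fun _ =>
        MeasurableSet.iInter fun _ => measSet_eq (hB' s) (hB s)
    have e : {ω | ∀ s, 1 ≤ s → s ≠ r+1 → s ≠ (r+1)+1 → B s (n+1) ω = B s n ω} =
        (⋂ s, ⋂ (_ : 1 ≤ s), ⋂ (_ : s ≠ r+1), ⋂ (_ : s ≠ (r+1)+1),
        {ω | B s (n+1) ω = B s n ω}) := by ext; simp
    rw [← e] at this
    exact this

lemma ee_sm (hEP : IsEwensPitman α θ μ F K B) (r n : ℕ) : StronglyMeasurable[F (n+1)] (ee K B r n) :=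
  stronglyMeasurable_const.indicator (evS_meas hEP r n)

lemma ee_nonneg (r n : ℕ) (ω : Ω) : 0 ≤ ee K B r n ω := Set.indicator_nonneg (by simp) _

lemma ee_le (r n : ℕ) (ω : Ω) : ee K B r n ω ≤ 1 := by
  classical
  unfold ee; rw [Set.indicator_apply]; split_ifs <;> simp

lemma ee_sq (r n : ℕ) (ω : Ω) : ee K B r n ω * ee K B r n ω = ee K B r n ω := by
  classical
  unfold ee; rw [Set.indicator_apply]; split_ifs <;> simp

lemma ee_int [IsProbabilityMeasure μ] (hEP : IsEwensPitman α θ μ F K B) (r n : ℕ) :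
    Integrable (ee K B r n) μ :=
  Integrable.of_bound ((ee_sm hEP r n).mono (F.le _)).aestronglyMeasurable 1
    (ae_of_all _ fun ω => by rw [Real.norm_eq_abs, abs_of_nonneg (ee_nonneg r n ω)]; exact ee_le r n ω)

lemma ee_condExp (hEP : IsEwensPitman α θ μ F K B) (r n : ℕ) (hn : 1 ≤ n) :
    μ[ee K B r n | F n] =ᵐ[μ] pp α θ K B r n := by
  rcases r with _ | r
  · exact hEP.trans_new n hn
  · exact hEP.trans_grow n hn (r+1) (by omega)

lemma ev_disj (n : ℕ) (ω : Ω) (r s : ℕ) (h : r < s) (hr : ω ∈ evS K B r n) (hs : ω ∈ evS K B s n) :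
    False := by
  obtain ⟨s, rfl⟩ : ∃ m, s = m + 1 := ⟨s - 1, by omega⟩
  rcases r with _ | r
  · have := hr.1; have := hs.1; omega
  · have h1 := hs.2.1
    have h2 := hr.2.2.1
    have h3 := hr.2.2.2 (s+1) (by omega) (by omega)
    by_cases h4 : s + 1 = r + 1 + 1
    · rw [← h4] at h2; omega
    · have := h3 h4; omega

lemma ee_disj (n : ℕ) (ω : Ω) (r s : ℕ) (h : r ≠ s) : ee K B r n ω * ee K B s n ω = 0 := by
  by_contra hne
  have h1 := left_ne_zero_of_mul hne
  have h2 := right_ne_zero_of_mul hne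
  have h1 := Set.mem_of_indicator_ne_zero h1
  have h2 := Set.mem_of_indicator_ne_zero h2
  rcases lt_or_gt_of_ne h with h | h
  · exact ev_disj n ω _ _ h h1 h2
  · exact ev_disj n ω _ _ h h2 h1

lemma ae_basic (hEP : IsEwensPitman α θ μ F K B) : ∀ᵐ ω ∂μ, ∀ n, 1 ≤ n →
    (K n ω = ∑ r ∈ Finset.Icc 1 n, B r n ω) ∧ (n = ∑ r ∈ Finset.Icc 1 n, r * B r n ω) ∧
    (1 ≤ K n ω ∧ K n ω ≤ n) ∧ (∀ r, 1 ≤ r → B r n ω ≤ K n ω) ∧ ∀ r, n < r → B r n ω = 0 := by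
  have h1 : ∀ᵐ ω ∂μ, ∀ n, 1 ≤ n → K n ω = ∑ r ∈ Finset.Icc 1 n, B r n ω :=
    ae_all_iff.2 fun n => by
      by_cases h : 1 ≤ n
      · filter_upwards [hEP.sum_blocks n h] with ω hω _ using hω
      · exact ae_of_all _ fun ω h' => absurd h' h
  have h2 : ∀ᵐ ω ∂μ, ∀ n, 1 ≤ n → n = ∑ r ∈ Finset.Icc 1 n, r * B r n ω :=
    ae_all_iff.2 fun n => by
      by_cases h : 1 ≤ n
      · filter_upwards [hEP.sum_sizes n h] with ω hω _ using hω
      · exact ae_of_all _ fun ω h' => absurd h' h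
  have h3 : ∀ᵐ ω ∂μ, ∀ r n, n < r → B r n ω = 0 :=
    ae_all_iff.2 fun r => ae_all_iff.2 fun n => by
      by_cases h : n < r
      · filter_upwards [hEP.B_eq_zero r n h] with ω hω _ using hω
      · exact ae_of_all _ fun ω h' => absurd h' h
  filter_upwards [h1, h2, h3] with ω h1 h2 h3 n hn
  refine ⟨h1 n hn, h2 n hn, ⟨?_, ?_⟩, ?_, fun r hr => h3 r n hr⟩
  · by_contra hK
    have hK0 : ∑ r ∈ Finset.Icc 1 n, B r n ω = 0 := by have := h1 n hn; omega
    rw [Finset.sum_eq_zero_iff] at hK0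
    have := h2 n hn
    rw [Finset.sum_eq_zero (fun r hr => by rw [hK0 r hr, mul_zero])] at this
    omega
  · rw [h1 n hn]
    conv_rhs => rw [h2 n hn]
    refine Finset.sum_le_sum fun r hr => ?_
    exact Nat.le_mul_of_pos_left _ (by simp at hr; omega)
  · intro r hr
    by_cases hrn : r ≤ n
    · rw [h1 n hn]
      exact Finset.single_le_sum (f := fun r => B r n ω) (fun _ _ => Nat.zero_le _)
        (Finset.mem_Icc.2 ⟨hr, hrn⟩)
    · rw [h3 r n (by omega)]; exact Nat.zero_le _

lemma pp_sum (hα1 : α < 1) (hθ : 0 < α + θ)  (hEP : IsEwensPitman α θ μ F K B) :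
    ∀ᵐ ω ∂μ, ∀ n, 1 ≤ n → ∑ r ∈ Finset.range (n+1), pp α θ K B r n ω = 1 := by
  filter_upwards [ae_basic hEP] with ω hω n hn
  obtain ⟨h1, h2, -⟩ := hω n hn
  have hn' : (1:ℝ) ≤ n := by exact_mod_cast hn
  have hpos : (0:ℝ) < n + θ := by linarith
  rw [Finset.sum_range_succ']
  simp only [pp]
  rw [← Finset.sum_div, ← add_div, div_eq_one_iff_eq hpos.ne']
  have e : ∀ f : ℕ → ℝ, ∑ r ∈ Finset.range n, f (r+1) = ∑ r ∈ Finset.Icc 1 n, f r := by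
    intro f
    rw [Finset.range_eq_Ico, Finset.sum_Ico_add' f 0 n 1]; rfl
  rw [e fun r => ((r:ℝ) - α) * (B r n ω : ℝ)]
  have h1' : (K n ω : ℝ) = ∑ r ∈ Finset.Icc 1 n, (B r n ω : ℝ) := by rw [h1]; push_cast; rfl
  have h2' : (n : ℝ) = ∑ r ∈ Finset.Icc 1 n, (r : ℝ) * (B r n ω : ℝ) := by
    conv_lhs => rw [h2]
    push_cast; rfl
  simp only [sub_mul, Finset.sum_sub_distrib]
  rw [← h2', ← Finset.mul_sum, ← h1']; ring

lemma ee_sum (hα1 : α < 1) (hθ : 0 < α + θ)  (hEP : IsEwensPitman α θ μ F K B) :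
    ∀ᵐ ω ∂μ, ∀ n, 1 ≤ n → ∃ r, ω ∈ evS K B r n := by
  have := hEP.prob
  refine ae_all_iff.2 fun n => ?_
  by_cases hn : 1 ≤ n
  swap
  · exact ae_of_all _ fun ω h' => absurd h' hn
  have hle : ∀ ω, ∑ r ∈ Finset.range (n+1), ee K B r n ω ≤ 1 := by
    intro ω
    by_cases h : ∃ r, ω ∈ evS K B r n
    · obtain ⟨r, hr⟩ := h
      have : ∀ s, s ≠ r → ee K B s n ω = 0 := by
        intro s hs
        have := ee_disj (K := K) (B := B) n ω s r hs
        have h1 : ee K B r n ω = 1 := Set.indicator_of_mem hr _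
        rwa [h1, mul_one] at this
      by_cases hrn : r ∈ Finset.range (n+1)
      · rw [Finset.sum_eq_single_of_mem r hrn fun s _ hs => this s hs]; exact ee_le _ _ _
      · rw [Finset.sum_eq_zero fun s hs => this s (by rintro rfl; exact hrn hs)]; exact zero_le_one
    · push Not at h
      rw [Finset.sum_eq_zero fun s _ => show ee K B s n ω = 0 from Set.indicator_of_notMem (h s) _]; exact zero_le_one
  have hint : ∫ ω, ∑ r ∈ Finset.range (n+1), ee K B r n ω ∂μ = 1 := by
    rw [integral_finsetSum _ fun r _ => ee_int hEP r n]
    have : ∀ r ∈ Finset.range (n+1), ∫ ω, ee K B r n ω ∂μ = ∫ ω, pp α θ K B r n ω ∂μ := by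
      intro r _
      rw [← integral_condExp (F.le n), integral_congr_ae (ee_condExp hEP r n hn)]
    rw [Finset.sum_congr rfl this, ← integral_finsetSum]
    · rw [integral_congr_ae (g := fun _ => (1:ℝ))]
      · simp
      · filter_upwards [pp_sum hα1 hθ hEP] with ω hω using hω n hn
    · intro r _
      exact integrable_condExp.congr (ee_condExp hEP r n hn)
  have hz : ∫ ω, (1 - ∑ r ∈ Finset.range (n+1), ee K B r n ω) ∂μ = 0 := by
    rw [integral_sub (integrable_const _) (integrable_finsetSum _ fun r _ => ee_int hEP r n), hint]
    simp
  rw [integral_eq_zero_iff_of_nonneg (fun ω => sub_nonneg.2 (hle ω))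
    ((integrable_const _).sub (integrable_finsetSum _ fun r _ => ee_int hEP r n))] at hz
  filter_upwards [hz] with ω hω _
  by_contra h
  push Not at h
  simp only [Pi.zero_apply] at hω
  rw [Finset.sum_eq_zero fun s _ => show ee K B s n ω = 0 from Set.indicator_of_notMem (h s) _] at hω
  simp at hω

/-- increments in terms of the event indicators -/
lemma incr (hα1 : α < 1) (hθ : 0 < α + θ)  (hEP : IsEwensPitman α θ μ F K B) :
    ∀ᵐ ω ∂μ, ∀ n, 1 ≤ n → ((K (n+1) ω : ℝ) = K n ω + ee K B 0 n ω) ∧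
      ∀ s, (B (s+1) (n+1) ω : ℝ) = B (s+1) n ω + (ee K B s n ω - ee K B (s+1) n ω) := by
  filter_upwards [ee_sum hα1 hθ hEP] with ω hω n hn
  obtain ⟨r, hr⟩ := hω n hn
  have h1 : ee K B r n ω = 1 := Set.indicator_of_mem hr _
  have h0 : ∀ s, s ≠ r → ee K B s n ω = 0 := by
    intro s hs
    have := ee_disj (K := K) (B := B) n ω s r hs
    rwa [h1, mul_one] at this
  rcases r with _ | r
  · refine ⟨by rw [h1, hr.1]; push_cast; ring, fun s => ?_⟩
    rw [h0 (s+1) (by omega)]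
    rcases s with _ | s
    · rw [h1, hr.2.1]; push_cast; ring
    · rw [h0 (s+1) (by omega), hr.2.2 _ (by omega)]; ring
  · refine ⟨by rw [h0 0 (by omega), hr.1]; ring, fun s => ?_⟩
    by_cases hs : s = r
    · subst hs
      rw [h1, h0 s (by omega), ← hr.2.1]; push_cast; ring
    by_cases hs' : s = r + 1
    · subst hs'
      rw [h1, h0 _ (by omega), hr.2.2.1]; push_cast; ring
    · rw [h0 s hs', h0 (s+1) (by omega), hr.2.2.2 _ (by omega) (by omega) (by omega)]; ring

end

def cc (α θ : ℝ) (n : ℕ) : ℝ := risingFactorial (θ + α + 1) (n-1) / risingFactorial (θ + 1) (n-1)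

section
variable {α θ : ℝ} {Ω : Type*} {mΩ : MeasurableSpace Ω}
    {μ : Measure Ω} {F : Filtration ℕ mΩ} {K : ℕ → Ω → ℕ} {B : ℕ → ℕ → Ω → ℕ}

lemma cc_pos (hα0 : 0 < α) (hα1 : α < 1) (hθ : 0 < α + θ) (n : ℕ) : 0 < cc α θ n :=
  div_pos (rf_pos (by linarith) _) (rf_pos (by linarith) _)

lemma cc_one : cc α θ 1 = 1 := by simp [cc, risingFactorial]

lemma cc_succ (n : ℕ) : cc α θ (n+2) = cc α θ (n+1) * (((n+1:ℕ) + θ + α) / ((n+1:ℕ) + θ)) := by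
  simp only [cc, show n + 2 - 1 = n + 1 by omega, Nat.add_sub_cancel, risingFactorial]
  rw [mul_div_mul_comm]; push_cast; congr 2 <;> ring

lemma cc_lim (hα0 : 0 < α) (hα1 : α < 1) (hθ : 0 < α + θ) :
    Tendsto (fun n : ℕ => cc α θ n / (n:ℝ) ^ α) atTop
      (𝓝 (Real.Gamma (θ+1) / Real.Gamma (θ + α + 1))) := by
  refine (rf_ratio' (θ+1) (θ+α+1) (by linarith)).congr fun n => ?_
  rw [show θ + 1 - (θ + α + 1) = -α by ring, Real.rpow_neg (Nat.cast_nonneg n)]; rfl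

lemma cc_tele (hα0 : 0 < α) (hα1 : α < 1) (hθ : 0 < α + θ) (n : ℕ) :
    ∑ k ∈ Finset.range n, cc α θ (k+1) / (((k+1:ℕ) + θ) * cc α θ (k+2) ^ 2) ≤
      1 / α * (1 - 1 / cc α θ (n+1)) := by
  induction n with
  | zero => simp [cc_one]
  | succ n ih =>
    rw [Finset.sum_range_succ]
    have h1 := cc_pos hα0 hα1 hθ (n+1)
    have h3 := cc_succ (α := α) (θ := θ) n
    have hN : (0:ℝ) < (n+1:ℕ) + θ := by push_cast; have : (0:ℝ) ≤ n := Nat.cast_nonneg n; linarith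
    set N : ℝ := (n+1:ℕ) + θ with hNd
    have key : cc α θ (n+1) / (N * cc α θ (n+2) ^ 2) ≤
        1 / α * (1 / cc α θ (n+1) - 1 / cc α θ (n+2)) := by
      rw [h3]
      have e : 1 / α * (1 / cc α θ (n+1) - 1 / (cc α θ (n+1) * ((N + α) / N))) =
          1 / (cc α θ (n+1) * (N + α)) := by
        field_simp; ring
      rw [e]
      have e2 : cc α θ (n+1) / (N * (cc α θ (n+1) * ((N + α) / N)) ^ 2) =
          1 / (cc α θ (n+1) * (N + α)) * (N / (N + α)) := by
        field_simp
      rw [e2]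
      apply mul_le_of_le_one_right (by positivity)
      rw [div_le_one (by positivity)]; linarith
    have e3 : 1 / α * (1 - 1 / cc α θ (n+1+1)) = 1 / α * (1 - 1 / cc α θ (n+1)) +
      1 / α * (1 / cc α θ (n+1) - 1 / cc α θ (n+2)) := by ring
    rw [e3]
    exact add_le_add ih key

lemma K_sm (hEP : IsEwensPitman α θ μ F K B) (n : ℕ) (f : ℕ → ℝ) :
    StronglyMeasurable[F n] (fun ω => f (K n ω)) :=
  ((measurable_from_top (f := f)).comp (hEP.meas_K n)).stronglyMeasurable

lemma B_sm (hEP : IsEwensPitman α θ μ F K B) (r n : ℕ) (f : ℕ → ℝ) :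
    StronglyMeasurable[F n] (fun ω => f (B r n ω)) :=
  ((measurable_from_top (f := f)).comp (hEP.meas_B r n)).stronglyMeasurable

lemma pp_sm (hEP : IsEwensPitman α θ μ F K B) (r n : ℕ) :
    StronglyMeasurable[F n] (pp α θ K B r n) := by
  rcases r with _ | r
  · exact K_sm hEP n fun k => (α * (k:ℝ) + θ) / ((n:ℝ) + θ)
  · exact B_sm hEP (r+1) n fun k => ((((r+1 : ℕ) : ℝ) - α) * (k : ℝ)) / ((n : ℝ) + θ)

lemma K_int (hEP : IsEwensPitman α θ μ F K B) (n : ℕ) (hn : 1 ≤ n) :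
    Integrable (fun ω => (K n ω : ℝ)) μ := by
  have := hEP.prob
  refine Integrable.of_bound ((K_sm hEP n fun k => (k:ℝ)).mono (F.le n)).aestronglyMeasurable n ?_
  filter_upwards [ae_basic hEP] with ω hω
  simp only [Real.norm_natCast]
  exact_mod_cast (hω n hn).2.2.1.2

lemma ee_integral (hEP : IsEwensPitman α θ μ F K B) (r n : ℕ) (hn : 1 ≤ n) :
    ∫ ω, ee K B r n ω ∂μ = ∫ ω, pp α θ K B r n ω ∂μ := by
  have := hEP.prob
  rw [← integral_condExp (F.le n), integral_congr_ae (ee_condExp hEP r n hn)]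

lemma EY (hα0 : 0 < α) (hα1 : α < 1) (hθ : 0 < α + θ) (hEP : IsEwensPitman α θ μ F K B) (n : ℕ) :
    ∫ ω, ((K (n+1) ω : ℝ) + θ / α) ∂μ = (1 + θ / α) * cc α θ (n+1) := by
  have := hEP.prob
  induction n with
  | zero =>
    rw [integral_congr_ae (g := fun _ => 1 + θ / α)]
    · simp [cc_one]
    · filter_upwards [hEP.init_K] with ω hω
      simp [hω]
  | succ n ih =>
    have hN : (0:ℝ) < (n+1:ℕ) + θ := by push_cast; have : (0:ℝ) ≤ n := Nat.cast_nonneg n; linarith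
    have i1 : Integrable (fun ω => (K (n+1) ω : ℝ) + θ / α) μ :=
      (K_int hEP (n+1) (by omega)).add (integrable_const _)
    rw [integral_congr_ae (g := fun ω => ((K (n+1) ω : ℝ) + θ / α) + ee K B 0 (n+1) ω)]
    · rw [integral_add i1 (ee_int hEP _ _), ee_integral hEP 0 (n+1) (by omega)]
      have : pp α θ K B 0 (n+1) = fun ω => (α / ((n+1:ℕ) + θ)) * ((K (n+1) ω : ℝ) + θ / α) := by
        funext ω; simp only [pp]; field_simp
      rw [this, integral_const_mul, ih, cc_succ]
      field_simp
    · filter_upwards [incr hα1 hθ hEP] with ω hω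
      rw [(hω (n+1) (by omega)).1]; ring

lemma pp_bd (hEP : IsEwensPitman α θ μ F K B) (r n : ℕ) (hn : 1 ≤ n) :
    ∀ᵐ ω ∂μ, 0 ≤ pp α θ K B r n ω ∧ pp α θ K B r n ω ≤ 1 := by
  have := hEP.prob
  have h1 : (0 : Ω → ℝ) ≤ᵐ[μ] μ[ee K B r n | F n] :=
    condExp_nonneg (ae_of_all _ fun ω => ee_nonneg r n ω)
  have h2 : μ[ee K B r n | F n] ≤ᵐ[μ] μ[fun _ => (1:ℝ) | F n] :=
    condExp_mono (ee_int hEP r n) (integrable_const _) (ae_of_all _ fun ω => ee_le r n ω)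
  rw [condExp_const (F.le n)] at h2
  filter_upwards [h1, h2, ee_condExp hEP r n hn] with ω h1 h2 h3
  rw [h3] at h1 h2
  exact ⟨h1, h2⟩

lemma pp_integral (hα0 : 0 < α) (hα1 : α < 1) (hθ : 0 < α + θ) (hEP : IsEwensPitman α θ μ F K B)
    (r n : ℕ) : ∫ ω, pp α θ K B r (n+1) ω ∂μ ≤
      ((r+1) * (1 + |θ| / (α + θ)) * (1 + θ / α)) * (cc α θ (n+1) / ((n+1:ℕ) + θ)) := by
  have := hEP.prob
  have hN : (0:ℝ) < (n+1:ℕ) + θ := by push_cast; have : (0:ℝ) ≤ n := Nat.cast_nonneg n; linarith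
  have i1 : Integrable (fun ω => (K (n+1) ω : ℝ) + θ / α) μ :=
      (K_int hEP (n+1) (by omega)).add (integrable_const _)
  have ip : Integrable (pp α θ K B r (n+1)) μ :=
    integrable_condExp.congr (ee_condExp hEP r (n+1) (by omega))
  calc ∫ ω, pp α θ K B r (n+1) ω ∂μ
      ≤ ∫ ω, ((r+1) * (1 + |θ| / (α + θ)) / ((n+1:ℕ) + θ)) * ((K (n+1) ω : ℝ) + θ / α) ∂μ := by
        refine integral_mono_ae ip (i1.const_mul _) ?_
        filter_upwards [ae_basic hEP] with ω hω
        obtain ⟨-, -, ⟨hK1, -⟩, hB, -⟩ := hω (n+1) (by omega)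
        have hK1 : (1:ℝ) ≤ K (n+1) ω := by exact_mod_cast hK1
        set k : ℝ := ((K (n+1) ω : ℕ) : ℝ) with hk
        have hY : (α + θ) / α ≤ k + θ / α := by rw [add_div, div_self hα0.ne']; linarith
        have hkY : k ≤ (1 + |θ| / (α + θ)) * (k + θ / α) := by
          have e1 : |θ| / (α + θ) * ((α + θ) / α) = |θ| / α := by field_simp
          have e2 : |θ| / (α + θ) * ((α + θ) / α) ≤ |θ| / (α + θ) * (k + θ / α) :=
            mul_le_mul_of_nonneg_left hY (by positivity)
          have e3 : -(θ / α) ≤ |θ| / α := by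
            rw [← neg_div]; exact div_le_div_of_nonneg_right (neg_le_abs θ) hα0.le
          linarith
        have hYpos : 0 < k + θ / α := lt_of_lt_of_le (by positivity) hY
        have hκ : (1:ℝ) ≤ 1 + |θ| / (α + θ) := by
          have : 0 ≤ |θ| / (α + θ) := by positivity
          linarith
        rw [div_mul_eq_mul_div]
        rcases r with _ | r
        · simp only [pp]
          apply div_le_div_of_nonneg_right _ hN.le
          rw [← hk, show α * k + θ = α * (k + θ / α) by field_simp]
          apply mul_le_mul_of_nonneg_right _ hYpos.le
          push_cast; linarith
        · simp only [pp]
          apply div_le_div_of_nonneg_right _ hN.le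
          have hb : (B (r+1) (n+1) ω : ℝ) ≤ k := by rw [hk]; exact_mod_cast hB (r+1) (by omega)
          have hr : (0:ℝ) ≤ r := Nat.cast_nonneg r
          rw [mul_assoc]
          apply mul_le_mul _ (hb.trans hkY) (Nat.cast_nonneg _) (by positivity)
          push_cast; linarith
    _ = _ := by rw [integral_const_mul, EY hα0 hα1 hθ hEP]; ring

def xi {Ω : Type*} (α θ : ℝ) (K : ℕ → Ω → ℕ) (B : ℕ → ℕ → Ω → ℕ) (r k : ℕ) : Ω → ℝ :=
  (1 / cc α θ (k+2)) • (ee K B r (k+1) - pp α θ K B r (k+1))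

lemma xi_conv (hα0 : 0 < α) (hα1 : α < 1) (hθ : 0 < α + θ) (hEP : IsEwensPitman α θ μ F K B)
    (r : ℕ) : ∀ᵐ ω ∂μ, ∃ l, Tendsto (fun n => ∑ k ∈ Finset.range n, xi α θ K B r k ω) atTop (𝓝 l) := by
  have := hEP.prob
  have ip : ∀ n, Integrable (pp α θ K B r (n+1)) μ := fun n =>
    integrable_condExp.congr (ee_condExp hEP r (n+1) (by omega))
  have hbd : ∀ n, ∀ᵐ ω ∂μ, |xi α θ K B r n ω| ≤ 1 / cc α θ (n+2) := by
    intro n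
    filter_upwards [pp_bd hEP r (n+1) (by omega)] with ω hω
    have h1 := cc_pos hα0 hα1 hθ (n+2)
    simp only [xi, Pi.smul_apply, Pi.sub_apply, smul_eq_mul]
    rw [abs_mul, abs_of_pos (by positivity : 0 < 1 / cc α θ (n+2))]
    apply mul_le_of_le_one_right (by positivity)
    have := ee_nonneg (K := K) (B := B) r (n+1) ω
    have := ee_le (K := K) (B := B) r (n+1) ω
    rw [abs_le]; constructor <;> linarith
  have had : ∀ n, StronglyMeasurable[shiftF F (n+1)] (xi α θ K B r n) := fun n =>
    ((ee_sm hEP r (n+1)).sub ((pp_sm hEP r (n+1)).mono (F.mono (Nat.le_succ _)))).const_smul _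
  set D := (r+1) * (1 + |θ| / (α + θ)) * (1 + θ / α) with hD
  have hD0 : 0 ≤ D := by
    have : 0 < 1 + θ / α := by
      rw [show 1 + θ / α = (α + θ) / α by field_simp]; positivity
    positivity
  refine L2conv (shiftF F) (xi α θ K B r) had _ hbd ?_
    (fun k => 2 * D * (cc α θ (k+1) / (((k+1:ℕ) + θ) * cc α θ (k+2) ^ 2))) ?_ (2 * D * (1 / α)) ?_
  · intro n
    refine (condExp_smul _ _ _).trans ?_
    have h1 := condExp_sub (ee_int hEP r (n+1)) (ip n) (F (n+1))
    have h2 := ee_condExp hEP r (n+1) (by omega)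
    have h3 : μ[pp α θ K B r (n+1) | F (n+1)] = pp α θ K B r (n+1) :=
      condExp_of_stronglyMeasurable (F.le _) (pp_sm hEP r (n+1)) (ip n)
    filter_upwards [h1, h2] with ω h1 h2
    change (1 / cc α θ (n+2)) * (μ[ee K B r (n+1) - pp α θ K B r (n+1) | F (n+1)]) ω = 0
    rw [h1, Pi.sub_apply, h2, h3]; simp
  · intro n
    have h1 := cc_pos hα0 hα1 hθ (n+2)
    have hp := pp_integral hα0 hα1 hθ hEP r n
    calc ∫ ω, (xi α θ K B r n ω)^2 ∂μ ≤ ∫ ω, (1 / cc α θ (n+2) ^ 2) *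
          (ee K B r (n+1) ω + pp α θ K B r (n+1) ω) ∂μ := by
          refine integral_mono_of_nonneg (ae_of_all _ fun ω => sq_nonneg _)
            (((ee_int hEP r (n+1)).add (ip n)).const_mul _) ?_
          filter_upwards [pp_bd hEP r (n+1) (by omega)] with ω hω
          simp only [xi, Pi.smul_apply, Pi.sub_apply, smul_eq_mul]
          rw [mul_pow, div_pow, one_pow]
          apply mul_le_mul_of_nonneg_left _ (by positivity)
          have h1 := ee_nonneg (K := K) (B := B) r (n+1) ω
          have h2 := ee_le (K := K) (B := B) r (n+1) ω
          nlinarith [hω.1, hω.2, mul_nonneg h1 hω.1, mul_nonneg h1 (sub_nonneg.2 h2), mul_nonneg hω.1 (sub_nonneg.2 hω.2)]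
      _ = (1 / cc α θ (n+2) ^ 2) * (2 * ∫ ω, pp α θ K B r (n+1) ω ∂μ) := by
          rw [integral_const_mul, integral_add (ee_int hEP r (n+1)) (ip n),
            ee_integral hEP r (n+1) (by omega)]; ring
      _ ≤ (1 / cc α θ (n+2) ^ 2) * (2 * (D * (cc α θ (n+1) / ((n+1:ℕ) + θ)))) := by
          gcongr
      _ = _ := by field_simp
  · intro n
    rw [← Finset.mul_sum]
    apply mul_le_mul_of_nonneg_left _ (by positivity)
    refine (cc_tele hα0 hα1 hθ n).trans ?_
    have h1 := cc_pos hα0 hα1 hθ (n+1)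
    apply mul_le_of_le_one_right (by positivity)
    have : 0 < 1 / cc α θ (n+1) := by positivity
    linarith

lemma conv_main (hα0 : 0 < α) (hα1 : α < 1) (hθ : 0 < α + θ) (hEP : IsEwensPitman α θ μ F K B) :
    ∀ᵐ ω ∂μ, ∃ l, ∀ r, Tendsto (fun n : ℕ => ((n:ℝ) + θ) * pp α θ K B r n ω / cc α θ n) atTop
      (𝓝 (wcf α r * l)) := by
  filter_upwards [ae_all_iff.2 (xi_conv hα0 hα1 hθ hEP), incr hα1 hθ hEP] with ω hx hi
  obtain ⟨T0, hT0⟩ := hx 0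
  have hcp := cc_pos hα0 hα1 hθ
  have hN : ∀ n : ℕ, (0:ℝ) < (n+1:ℕ) + θ := by
    intro n; push_cast; have : (0:ℝ) ≤ n := Nat.cast_nonneg n; linarith
  have hxi : ∀ r n, ee K B r (n+1) ω = pp α θ K B r (n+1) ω + cc α θ (n+2) * xi α θ K B r n ω := by
    intro r n
    have := (hcp (n+2)).ne'
    simp only [xi, Pi.smul_apply, Pi.sub_apply, smul_eq_mul]
    field_simp; ring
  have hy : ∀ n, ((K (n+1) ω : ℝ) + θ / α) / cc α θ (n+1) =
      ((K 1 ω : ℝ) + θ / α) + ∑ k ∈ Finset.range n, xi α θ K B 0 k ω := by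
    intro n
    induction n with
    | zero => simp [cc_one]
    | succ n ih =>
      rw [Finset.sum_range_succ, ← add_assoc, ← ih, (hi (n+1) (by omega)).1, hxi, cc_succ]
      have := hcp (n+1)
      have := hN n
      have : (0:ℝ) < (n+1:ℕ) + θ + α := by linarith
      simp only [pp]
      field_simp
      ring
  refine ⟨(K 1 ω : ℝ) + θ / α + T0, fun r => ?_⟩
  set l := (K 1 ω : ℝ) + θ / α + T0 with hl
  induction r with
  | zero =>
    rw [← tendsto_add_atTop_iff_nat 1]
    have := (hT0.const_add ((K 1 ω : ℝ) + θ / α)).const_mul α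
    rw [← hl] at this
    have hw : wcf α 0 = α := by simp [wcf, risingFactorial]
    rw [hw]
    refine this.congr fun n => ?_
    rw [← hy]
    simp only [pp]
    have := hcp (n+1)
    have := hN n
    field_simp
  | succ r ih =>
    obtain ⟨T1, hT1⟩ := hx r
    obtain ⟨T2, hT2⟩ := hx (r+1)
    have hB : Tendsto (fun n => (B (r+1) (n+1) ω : ℝ) / cc α θ (n+1)) atTop
        (𝓝 (sibuya α (r+1) * l)) := by
      refine detA _ (fun n => ((r+1:ℕ):ℝ) / ((1 + θ + α) + n))
        (fun n => (((n+1:ℕ):ℝ) + θ) * pp α θ K B r (n+1) ω / cc α θ (n+1) / ((r+1:ℕ):ℝ))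
        (fun n => xi α θ K B r n ω - xi α θ K B (r+1) n ω) _ (((r+1:ℕ):ℝ)/2) (T1 - T2)
        (by positivity) ?_ (a_bounds _ _ (by positivity)) ?_ ?_
      · refine Eventually.of_forall fun n => ?_
        rw [(hi (n+1) (by omega)).2, hxi, hxi, cc_succ]
        have := hcp (n+1)
        have := hN n
        have h5 : (0:ℝ) < (n+1:ℕ) + θ + α := by linarith
        have h6 : 1 + θ + α + (n:ℝ) = (n+1:ℕ) + θ + α := by push_cast; ring
        have h7 : (0:ℝ) < (r+1:ℕ) := by positivity
        rw [h6]
        have h8 : pp α θ K B (r+1) (n+1) ω = ((((r+1 : ℕ) : ℝ) - α) * (B (r+1) (n+1) ω : ℝ)) / (((n+1:ℕ) : ℝ) + θ) := rfl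
        rw [h8]
        field_simp
        ring
      · have h1 := ((tendsto_add_atTop_iff_nat 1).2 ih).div_const ((r+1:ℕ):ℝ)
        rw [wcf_sib] at h1
        have h7 : (0:ℝ) < (r+1:ℕ) := by positivity
        rwa [mul_assoc, mul_div_cancel_left₀ _ h7.ne'] at h1
      · simpa only [Finset.sum_sub_distrib] using hT1.sub hT2
    rw [← tendsto_add_atTop_iff_nat 1]
    have := hB.const_mul (((r+1 : ℕ) : ℝ) - α)
    rw [wcf_succ, mul_assoc]
    refine this.congr fun n => ?_
    simp only [pp]
    have := hcp (n+1)
    have := hN n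
    field_simp

end

def gg (x y : ℝ) (n : ℕ) : ℝ := risingFactorial y (n-1) / risingFactorial x (n-1)

lemma gg_pos {x y : ℝ} (hx : 0 < x) (hy : 0 < y) (n : ℕ) : 0 < gg x y n :=
  div_pos (rf_pos hy _) (rf_pos hx _)

lemma gg_succ (x y : ℝ) (n : ℕ) (hn : 1 ≤ n) : gg x y (n+1) = gg x y n * ((y + n - 1) / (x + n - 1)) := by
  obtain ⟨m, rfl⟩ : ∃ m, n = m + 1 := ⟨n - 1, by omega⟩
  simp only [gg, Nat.add_sub_cancel, risingFactorial]
  rw [mul_div_mul_comm]; push_cast; congr 2 <;> ring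

lemma gg_le {x y : ℝ} (hy : 0 < y) (hxy : y ≤ x) (n : ℕ) : gg x y n ≤ 1 := by
  have hx : 0 < x := by linarith
  unfold gg
  rw [div_le_one (rf_pos hx _), rf_eq_prod, rf_eq_prod]
  refine Finset.prod_le_prod (fun i _ => by positivity) fun i _ => by linarith

lemma lower_of_tendsto (u : ℕ → ℝ) (l : ℝ) (hl : 0 < l) (hu : ∀ n, 1 ≤ n → 0 < u n)
    (h : Tendsto u atTop (𝓝 l)) : ∃ c, 0 < c ∧ ∀ n, 1 ≤ n → c ≤ u n := by
  obtain ⟨N, hN⟩ := eventually_atTop.1 (h.eventually (lt_mem_nhds (half_lt_self hl)))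
  have : ∀ M : ℕ, ∃ c, 0 < c ∧ ∀ n, 1 ≤ n → n ≤ M → c ≤ u n := by
    intro M
    induction M with
    | zero => exact ⟨1, one_pos, fun n h1 h2 => by omega⟩
    | succ M ih =>
      obtain ⟨c, hc, h⟩ := ih
      refine ⟨min c (u (M+1)), lt_min hc (hu _ (by omega)), fun n h1 h2 => ?_⟩
      rcases Nat.lt_or_ge M n with h3 | h3
      · have : n = M + 1 := by omega
        rw [this]; exact min_le_right _ _
      · exact (min_le_left _ _).trans (h n h1 h3)
  obtain ⟨c, hc, h1⟩ := this N
  refine ⟨min c (l/2), lt_min hc (by linarith), fun n hn => ?_⟩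
  rcases le_total n N with h3 | h3
  · exact (min_le_left _ _).trans (h1 n hn h3)
  · exact (min_le_right _ _).trans (hN n h3).le

section
variable {α θ : ℝ} {Ω : Type*} {mΩ : MeasurableSpace Ω}
    {μ : Measure Ω} {F : Filtration ℕ mΩ} {K : ℕ → Ω → ℕ} {B : ℕ → ℕ → Ω → ℕ}

lemma neg_mart (hα0 : 0 < α) (hα1 : α < 1) (hθ : 0 < α + θ) (hEP : IsEwensPitman α θ μ F K B)
    (τ q : ℝ) (hτ : τ = 1 + θ / α) (hq : q = τ / 2) :
    ∀ᵐ ω ∂μ, ∃ l, Tendsto (fun n => gg τ (τ - q) (K (n+1) ω) / gg (1 + θ) (1 + θ - α * q) (n+1)) atTop (𝓝 l) := by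
  have := hEP.prob
  have hτ0 : 0 < τ := by rw [hτ, show 1 + θ / α = (α + θ) / α by field_simp]; positivity
  have hq0 : 0 < q := by linarith
  have hαq : α * q = (α + θ) / 2 := by rw [hq, hτ]; field_simp
  have hy : 0 < 1 + θ - α * q := by linarith
  have hx : 0 < 1 + θ := by linarith
  set d : ℕ → ℝ := gg (1 + θ) (1 + θ - α * q) with hd
  have hdpos : ∀ n, 0 < d n := gg_pos hx hy
  set g : ℕ → ℝ := gg τ (τ - q) with hg
  have hgpos : ∀ n, 0 < g n := gg_pos hτ0 (by linarith)
  have hgle : ∀ n, g n ≤ 1 := gg_le (by linarith) (by linarith)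
  set f : ℕ → Ω → ℝ := fun n ω => g (K (n+1) ω) / d (n+1) with hf
  have hsm : ∀ n, StronglyMeasurable[shiftF F n] (f n) := fun n => K_sm hEP (n+1) fun k => g k / d (n+1)
  have hfpos : ∀ n ω, 0 < f n ω := fun n ω => div_pos (hgpos _) (hdpos _)
  have gint : ∀ n, Integrable (fun ω => g (K (n+1) ω)) μ := by
    intro n
    refine Integrable.of_bound ((K_sm hEP (n+1) g).mono (F.le _)).aestronglyMeasurable 1
      (ae_of_all _ fun ω => ?_)
    rw [Real.norm_eq_abs, abs_of_pos (hgpos _)]; exact hgle _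
  have hint : ∀ n, Integrable (f n) μ := fun n => (gint n).div_const _
  have hcond : ∀ n, μ[f (n+1) | shiftF F n] =ᵐ[μ] f n := by
    intro n
    change μ[f (n+1) | F (n+1)] =ᵐ[μ] f n
    have hN : (0:ℝ) < (n+1:ℕ) + θ := by push_cast; have : (0:ℝ) ≤ n := Nat.cast_nonneg n; linarith
    set h : Ω → ℝ := fun ω => g (K (n+1) ω) * q / ((K (n+1) ω : ℝ) + θ / α) with hh
    have hhm : StronglyMeasurable[F (n+1)] h := K_sm hEP (n+1) fun k => g k * q / ((k:ℝ) + θ / α)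
    have hY : ∀ᵐ ω ∂μ, τ ≤ (K (n+1) ω : ℝ) + θ / α := by
      filter_upwards [ae_basic hEP] with ω hω
      have : (1:ℝ) ≤ K (n+1) ω := by exact_mod_cast (hω (n+1) (by omega)).2.2.1.1
      linarith
    have hhb : ∀ᵐ ω ∂μ, ‖h ω‖ ≤ q / τ := by
      filter_upwards [hY] with ω hω
      have hYp : 0 < (K (n+1) ω : ℝ) + θ / α := by linarith
      have hgp := hgpos (K (n+1) ω)
      rw [Real.norm_eq_abs, abs_of_nonneg (by simp only [hh]; positivity)]
      simp only [hh]
      apply div_le_div₀ hq0.le _ hτ0 hω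
      exact mul_le_of_le_one_left hq0.le (hgle _)
    have hei : Integrable (h * ee K B 0 (n+1)) μ :=
      (ee_int hEP 0 (n+1)).bdd_mul (hhm.mono (F.le _)).aestronglyMeasurable hhb
    have e1 : f (n+1) =ᵐ[μ] (1 / d (n+2)) • ((fun ω => g (K (n+1) ω)) - h * ee K B 0 (n+1)) := by
      filter_upwards [incr hα1 hθ hEP, ee_sum hα1 hθ hEP, ae_basic hEP, hY] with ω h1 h2 h3 h4
      have hYp : 0 < (K (n+1) ω : ℝ) + θ / α := by linarith
      obtain ⟨⟨hK, -⟩, -⟩ := (h3 (n+1) (by omega)).2.2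
      simp only [hf, Pi.smul_apply, Pi.sub_apply, Pi.mul_apply, smul_eq_mul]
      have hee : ee K B 0 (n+1) ω = 0 ∨ ee K B 0 (n+1) ω = 1 := by
        have := ee_sq (K := K) (B := B) 0 (n+1) ω
        rcases eq_or_ne (ee K B 0 (n+1) ω) 0 with h | h
        · exact Or.inl h
        · exact Or.inr (mul_left_cancel₀ h (by rw [this, mul_one]))
      have hi := (h1 (n+1) (by omega)).1
      rcases hee with h | h
      · rw [h, add_zero] at hi
        have : K (n+1+1) ω = K (n+1) ω := by exact_mod_cast hi
        rw [this, h]; ring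
      · rw [h] at hi
        have : K (n+1+1) ω = K (n+1) ω + 1 := by exact_mod_cast hi
        rw [this, h, hg, gg_succ _ _ _ hK]
        simp only [hh]
        have e5 : τ - q + (K (n+1) ω : ℝ) - 1 = (K (n+1) ω : ℝ) + θ / α - q := by rw [hτ]; ring
        have e6 : τ + (K (n+1) ω : ℝ) - 1 = (K (n+1) ω : ℝ) + θ / α := by rw [hτ]; ring
        rw [e5, e6, ← hg]
        have := hdpos (n+2)
        generalize (K (n+1) ω : ℝ) + θ / α = Y at *
        field_simp
    have e2 := condExp_sub (gint n) hei (F (n+1))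
    have e3 := condExp_mul_of_stronglyMeasurable_left hhm hei (ee_int hEP 0 (n+1))
    have e4 := ee_condExp hEP 0 (n+1) (by omega)
    have e5 : μ[fun ω => g (K (n+1) ω) | F (n+1)] = fun ω => g (K (n+1) ω) :=
      condExp_of_stronglyMeasurable (F.le _) (K_sm hEP (n+1) g) (gint n)
    refine (condExp_congr_ae e1).trans ((condExp_smul _ _ _).trans ?_)
    filter_upwards [e2, e3, e4, hY] with ω e2 e3 e4 hY
    have hYp : 0 < (K (n+1) ω : ℝ) + θ / α := by linarith
    rw [Pi.smul_apply, e2, Pi.sub_apply, e3, Pi.mul_apply, e4, e5]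
    simp only [hf, hh, pp, smul_eq_mul]
    have e7 : α * (K (n+1) ω : ℝ) + θ = α * ((K (n+1) ω : ℝ) + θ / α) := by field_simp
    have e8 : d (n+2) = d (n+1) * (((n+1:ℕ) + θ - α * q) / ((n+1:ℕ) + θ)) := by
      rw [hd, gg_succ _ _ _ (by omega)]; congr 2 <;> ring
    rw [e7, e8]
    have h9 := hdpos (n+1)
    have h10 : 0 < ((n+1:ℕ):ℝ) + θ - α * q := by
      push_cast; have : (0:ℝ) ≤ n := Nat.cast_nonneg n; linarith
    generalize (K (n+1) ω : ℝ) + θ / α = Y at *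
    field_simp
  have hconst : ∀ n, ∫ ω, |f n ω| ∂μ ≤ ∫ ω, f 0 ω ∂μ := by
    intro n
    have : ∀ ω, |f n ω| = f n ω := fun ω => abs_of_pos (hfpos n ω)
    simp only [this]
    induction n with
    | zero => exact le_rfl
    | succ n ih =>
      rw [← integral_condExp ((shiftF F).le n), integral_congr_ae (hcond n)]
      exact ih fun ω => abs_of_pos (hfpos n ω)
  exact mart_conv (shiftF F) f hsm hint hcond _ hconst

lemma K_pos (hα0 : 0 < α) (hα1 : α < 1) (hθ : 0 < α + θ) (hEP : IsEwensPitman α θ μ F K B) :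
    ∀ᵐ ω ∂μ, ¬ Tendsto (fun n : ℕ => (K n ω : ℝ) / (n:ℝ) ^ α) atTop (𝓝 0) := by
  obtain ⟨τ, hτ⟩ : ∃ τ, τ = 1 + θ / α := ⟨_, rfl⟩
  obtain ⟨q, hq⟩ : ∃ q, q = τ / 2 := ⟨_, rfl⟩
  have hτ0 : 0 < τ := by rw [hτ, show 1 + θ / α = (α + θ) / α by field_simp]; positivity
  have hq0 : 0 < q := by linarith
  have hαq : α * q = (α + θ) / 2 := by rw [hq, hτ]; field_simp
  have hy : 0 < 1 + θ - α * q := by linarith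
  have hx : 0 < 1 + θ := by linarith
  filter_upwards [neg_mart hα0 hα1 hθ hEP τ q hτ hq, ae_basic hEP] with ω hω hb hlim
  obtain ⟨l, hl⟩ := hω
  obtain ⟨c, hc, hcg⟩ := lower_of_tendsto (fun n => gg τ (τ - q) n * (n:ℝ) ^ q)
    (Real.Gamma τ / Real.Gamma (τ - q))
    (div_pos (Real.Gamma_pos_of_pos hτ0) (Real.Gamma_pos_of_pos (by linarith)))
    (fun n hn => mul_pos (gg_pos hτ0 (by linarith) n) (Real.rpow_pos_of_pos (by exact_mod_cast hn) _))
    (by have := rf_ratio' τ (τ - q) (by linarith)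
        rwa [show τ - (τ - q) = q by ring] at this)
  have hd : Tendsto (fun n : ℕ => gg (1+θ) (1 + θ - α * q) n * (n:ℝ) ^ (α * q)) atTop
      (𝓝 (Real.Gamma (1+θ) / Real.Gamma (1 + θ - α * q))) := by
    have := rf_ratio' (1+θ) (1 + θ - α * q) hy
    rwa [show 1 + θ - (1 + θ - α * q) = α * q by ring] at this
  have hl' : Tendsto (fun n => gg τ (τ - q) (K n ω) / gg (1 + θ) (1 + θ - α * q) n) atTop (𝓝 l) :=
    (tendsto_add_atTop_iff_nat 1).1 hl
  have h0 : Tendsto (fun n : ℕ => ((K n ω : ℝ) / (n:ℝ) ^ α) ^ q) atTop (𝓝 0) := by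
    have := hlim.rpow_const (p := q) (Or.inr hq0.le)
    rwa [Real.zero_rpow hq0.ne'] at this
  have h1 := (hl'.mul h0).mul hd
  rw [mul_zero, zero_mul] at h1
  have h2 : c ≤ 0 := by
    refine ge_of_tendsto h1 ?_
    filter_upwards [eventually_ge_atTop 1] with n hn
    have hn' : (0:ℝ) < n := by exact_mod_cast hn
    refine (hcg (K n ω) (hb n hn).2.2.1.1).trans (le_of_eq ?_)
    rw [Real.div_rpow (Nat.cast_nonneg _) (by positivity), ← Real.rpow_mul hn'.le]
    have h3 := gg_pos hx hy n
    have h4 := Real.rpow_pos_of_pos hn' (α * q)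
    generalize gg (1+θ) (1 + θ - α * q) n = dn at h3 ⊢
    generalize (n:ℝ) ^ (α * q) = en at h4 ⊢
    field_simp
  linarith

end
section
variable {α θ : ℝ} {Ω : Type*} {mΩ : MeasurableSpace Ω}
    {μ : Measure Ω} {F : Filtration ℕ mΩ} {K : ℕ → Ω → ℕ} {B : ℕ → ℕ → Ω → ℕ}

lemma nneg_lim (hα0 : 0 < α) : Tendsto (fun n : ℕ => (n:ℝ) ^ (-α)) atTop (𝓝 0) :=
  (tendsto_rpow_neg_atTop hα0).comp tendsto_natCast_atTop_atTop

lemma lims (hα0 : 0 < α) (hα1 : α < 1) (hθ : 0 < α + θ) (hEP : IsEwensPitman α θ μ F K B) :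
    ∃ S : Ω → ℝ, ∀ᵐ ω ∂μ, (0 < S ω ∧ Tendsto (fun n => (K n ω : ℝ) / (n : ℝ) ^ α) atTop (𝓝 (S ω))) ∧
      (∀ r, Tendsto (fun n : ℕ => pp α θ K B r n ω * (n:ℝ) ^ (1-α)) atTop (𝓝 (wcf α r * S ω))) ∧
      ∀ i, ∃ L, Tendsto (fun n : ℕ => Sproc α K B i n ω / (n:ℝ) ^ α) atTop (𝓝 L) := by
  suffices h : ∀ᵐ ω ∂μ, ∃ s : ℝ,
      (0 < s ∧ Tendsto (fun n => (K n ω : ℝ) / (n : ℝ) ^ α) atTop (𝓝 s)) ∧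
      (∀ r, Tendsto (fun n : ℕ => pp α θ K B r n ω * (n:ℝ) ^ (1-α)) atTop (𝓝 (wcf α r * s))) ∧
      ∀ i, ∃ L, Tendsto (fun n : ℕ => Sproc α K B i n ω / (n:ℝ) ^ α) atTop (𝓝 L) from
    Filter.skolem.1 h
  filter_upwards [conv_main hα0 hα1 hθ hEP, K_pos hα0 hα1 hθ hEP] with ω ⟨l, hl⟩ hK0
  refine ⟨l * (Real.Gamma (θ+1) / Real.Gamma (θ + α + 1)), ?_⟩
  set s := l * (Real.Gamma (θ+1) / Real.Gamma (θ + α + 1)) with hs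
  have hpp : ∀ r, Tendsto (fun n : ℕ => pp α θ K B r n ω * (n:ℝ) ^ (1-α)) atTop (𝓝 (wcf α r * s)) := by
    intro r
    have h := ((hl r).mul (cc_lim hα0 hα1 hθ)).mul (tendsto_shift_ratio 0 θ)
    rw [show wcf α r * l * (Real.Gamma (θ+1) / Real.Gamma (θ + α + 1)) * 1 = wcf α r * s by
      rw [hs]; ring] at h
    refine h.congr' ?_
    filter_upwards [eventually_ge_atTop 1, ev_pos θ] with n hn hn2
    have hn' : (0:ℝ) < n := by exact_mod_cast hn
    have h1 := cc_pos hα0 hα1 hθ n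
    have h2 := Real.rpow_pos_of_pos hn' α
    rw [Real.rpow_sub hn', Real.rpow_one, add_comm (n:ℝ) θ]
    field_simp
    ring
  have hqq : ∀ r, Tendsto (fun n : ℕ => (((n:ℝ)+θ) * pp α θ K B r n ω) / (n:ℝ) ^ α) atTop
      (𝓝 (wcf α r * s)) := by
    intro r
    have h := (hpp r).mul (tendsto_shift_ratio θ 0)
    rw [mul_one] at h
    refine h.congr' ?_
    filter_upwards [eventually_ge_atTop 1] with n hn
    have hn' : (0:ℝ) < n := by exact_mod_cast hn
    have h2 := Real.rpow_pos_of_pos hn' α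
    rw [Real.rpow_sub hn', Real.rpow_one, zero_add]
    field_simp
    ring
  have hK : Tendsto (fun n => (K n ω : ℝ) / (n : ℝ) ^ α) atTop (𝓝 s) := by
    have h := (((hqq 0).sub ((nneg_lim hα0).const_mul θ)).div_const α)
    have e : (wcf α 0 * s - θ * 0) / α = s := by simp [wcf, risingFactorial]; field_simp
    rw [e] at h
    refine h.congr' ?_
    filter_upwards [eventually_ge_atTop 1, ev_pos θ] with n hn hn2
    have hn' : (0:ℝ) < n := by exact_mod_cast hn
    have h2 := Real.rpow_pos_of_pos hn' α
    have h3 : (n:ℝ) + θ ≠ 0 := by linarith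
    rw [Real.rpow_neg hn'.le]
    simp only [pp]
    field_simp
    ring
  have hB : ∀ r, 1 ≤ r → ∃ L, Tendsto (fun n => (B r n ω : ℝ) / (n : ℝ) ^ α) atTop (𝓝 L) := by
    intro r hr
    obtain ⟨r, rfl⟩ : ∃ m, r = m + 1 := ⟨r-1, by omega⟩
    refine ⟨_, ((hqq (r+1)).div_const (((r+1:ℕ):ℝ) - α)).congr' ?_⟩
    filter_upwards [eventually_ge_atTop 1, ev_pos θ] with n hn hn2
    have hn' : (0:ℝ) < n := by exact_mod_cast hn
    have h2 := Real.rpow_pos_of_pos hn' α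
    have h3 : (n:ℝ) + θ ≠ 0 := by linarith
    have h4 : (((r+1:ℕ):ℝ) - α) ≠ 0 := by push_cast; have : (0:ℝ) ≤ r := Nat.cast_nonneg r; linarith
    simp only [pp]
    field_simp
  have hs0 : 0 ≤ s := ge_of_tendsto' hK fun n => by positivity
  have hs1 : s ≠ 0 := fun h => hK0 (h ▸ hK)
  refine ⟨⟨lt_of_le_of_ne hs0 hs1.symm, hK⟩, hpp, fun i => ?_⟩
  choose! L hL using hB
  refine ⟨∑ r ∈ Finset.Icc 1 i, bCoef α i r * L r + (-1:ℝ)^i * sibuya α i * s, ?_⟩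
  have h1 : Tendsto (fun n : ℕ => ∑ r ∈ Finset.Icc 1 i, bCoef α i r * ((B r n ω : ℝ) / (n : ℝ) ^ α))
      atTop (𝓝 (∑ r ∈ Finset.Icc 1 i, bCoef α i r * L r)) :=
    tendsto_finsetSum _ fun r hr => (hL r (Finset.mem_Icc.1 hr).1).const_mul _
  refine (h1.add (hK.const_mul ((-1:ℝ)^i * sibuya α i))).congr fun n => ?_
  rw [Sproc, add_div, Finset.sum_div]
  congr 1
  · exact Finset.sum_congr rfl fun r _ => by ring
  · ring

lemma Sproc_bbc (i n N : ℕ) (hi : 1 ≤ i) (hN : i ≤ N) (ω : Ω) : Sproc α K B i n ω =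
    ∑ s ∈ Finset.range N, bbc α i (s+1) * (B (s+1) n ω : ℝ) - bbc α i 0 * (K n ω : ℝ) := by
  rw [Sproc, bbc_zero α i hi]
  have : ∑ s ∈ Finset.range N, bbc α i (s+1) * (B (s+1) n ω : ℝ) =
      ∑ r ∈ Finset.Icc 1 i, bCoef α i r * (B r n ω : ℝ) := by
    obtain ⟨m, rfl⟩ := Nat.exists_eq_add_of_le hN
    rw [Finset.sum_range_add, Finset.sum_eq_zero (s := Finset.range m), add_zero,
      show Finset.Icc 1 i = Finset.Ico 1 (i+1) by ext; simp,
      Finset.sum_Ico_eq_sum_range]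
    · refine Finset.sum_congr (by simp) fun s hs => ?_
      have hs := Finset.mem_range.1 hs
      rw [bbc, if_pos (by omega), add_comm 1 s]
    · intro x _
      rw [bbc, if_neg (by omega), zero_mul]
  rw [this]; ring

lemma dS (hα1 : α < 1) (hθ : 0 < α + θ) (hEP : IsEwensPitman α θ μ F K B)
    (i N : ℕ) (hi : 1 ≤ i) (hN : i + 1 ≤ N) : ∀ᵐ ω ∂μ, ∀ k, 1 ≤ k →
    Sproc α K B i (k+1) ω = Sproc α K B i k ω + ∑ r ∈ Finset.range N, ucf α i r * ee K B r k ω := by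
  filter_upwards [incr hα1 hθ hEP] with ω h k hk
  obtain ⟨h1, h2⟩ := h k hk
  rw [Sproc_bbc i (k+1) N hi (by omega), Sproc_bbc i k N hi (by omega), h1]
  simp only [h2]
  have e1 : ∑ s ∈ Finset.range N, bbc α i (s+1) * ee K B (s+1) k ω + bbc α i 0 * ee K B 0 k ω =
      ∑ s ∈ Finset.range N, bbc α i s * ee K B s k ω := by
    rw [← Finset.sum_range_succ' (fun s => bbc α i s * ee K B s k ω), Finset.sum_range_succ,
      bbc, if_neg (by omega)]
    ring
  simp only [ucf, sub_mul, mul_add, mul_sub, Finset.sum_add_distrib, Finset.sum_sub_distrib]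
  linarith

lemma prod_ee (u v : ℕ → ℝ) (N k : ℕ) (ω : Ω) :
    (∑ r ∈ Finset.range N, u r * ee K B r k ω) * (∑ r ∈ Finset.range N, v r * ee K B r k ω) =
    ∑ r ∈ Finset.range N, u r * v r * ee K B r k ω := by
  rw [Finset.sum_mul]
  refine Finset.sum_congr rfl fun r hr => ?_
  rw [Finset.mul_sum, Finset.sum_eq_single_of_mem r hr]
  · have := ee_sq (K := K) (B := B) r k ω
    linear_combination u r * v r * this
  · intro s _ hs
    have := ee_disj (K := K) (B := B) k ω r s hs.symm
    linear_combination u r * v s * this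

lemma cond_quad (hEP : IsEwensPitman α θ μ F K B) (k : ℕ) (hk : 1 ≤ k) (N : ℕ) (h : ℕ → Ω → ℝ)
    (g : Ω → ℝ) (hsm : ∀ r, StronglyMeasurable[F k] (h r)) (hg : StronglyMeasurable[F k] g)
    (hb : ∀ r, MemLp (h r) ⊤ μ) (hgb : MemLp g ⊤ μ) :
    μ[fun ω => ∑ r ∈ Finset.range N, h r ω * ee K B r k ω + g ω | F k] =ᵐ[μ]
      fun ω => ∑ r ∈ Finset.range N, h r ω * pp α θ K B r k ω + g ω := by
  have := hEP.prob
  have hem : ∀ r, MemLp (ee K B r k) ⊤ μ := fun r =>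
    memLp_top_of_bound ((ee_sm hEP r k).mono (F.le _)).aestronglyMeasurable 1
      (ae_of_all _ fun ω => by
        rw [Real.norm_eq_abs, abs_of_nonneg (ee_nonneg r k ω)]; exact ee_le r k ω)
  have hint : ∀ r, Integrable (h r * ee K B r k) μ := fun r =>
    MemLp.integrable le_top (MemLp.mul (r := ⊤) (hem r) (hb r))
  have hc : ∀ r, μ[h r * ee K B r k | F k] =ᵐ[μ] h r * pp α θ K B r k := fun r => by
    filter_upwards [condExp_mul_of_stronglyMeasurable_left (hsm r) (hint r) (ee_int hEP r k),
      ee_condExp hEP r k hk] with ω h1 h2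
    rw [h1, Pi.mul_apply, Pi.mul_apply, h2]
  have e : (fun ω => ∑ r ∈ Finset.range N, h r ω * ee K B r k ω + g ω) =
      (∑ r ∈ Finset.range N, h r * ee K B r k) + g := by
    ext ω; simp
  rw [e]
  have hgi := hgb.integrable le_top
  filter_upwards [condExp_add (integrable_finsetSum' _ fun r _ => hint r) hgi (F k),
    condExp_finsetSum (s := Finset.range N) (fun r _ => hint r) (F k),
    ae_all_iff.2 hc] with ω h1 h2 h3
  rw [h1, Pi.add_apply, h2, condExp_of_stronglyMeasurable (F.le k) hg hgi, Finset.sum_apply]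
  simp [h3]

end

def gS {Ω : Type*} (α θ : ℝ) (K : ℕ → Ω → ℕ) (B : ℕ → ℕ → Ω → ℕ) (i k : ℕ) (ω : Ω) : ℝ :=
  ((i:ℝ) - α) / (θ + k) * (Sproc α K B i k ω + (-1 : ℝ) ^ i * sibuya α i * θ / α)

section
variable {α θ : ℝ} {Ω : Type*} {mΩ : MeasurableSpace Ω}
    {μ : Measure Ω} {F : Filtration ℕ mΩ} {K : ℕ → Ω → ℕ} {B : ℕ → ℕ → Ω → ℕ}

lemma aCoef_step (hα1 : α < 1) (hθ : 0 < α + θ) (i k : ℕ) (hi : 1 ≤ i) (hk : i + 1 ≤ k) :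
    aCoef α θ i k = aCoef α θ i (k+1) * (1 - ((i:ℝ) - α) / (θ + k)) := by
  obtain ⟨m, rfl⟩ : ∃ m, k = m + 1 := ⟨k-1, by omega⟩
  have hm : (i:ℝ) ≤ m := by exact_mod_cast (by omega : i ≤ m)
  have hi' : (1:ℝ) ≤ i := by exact_mod_cast hi
  rw [aCoef, if_neg (by omega), aCoef, if_neg (by omega)]
  simp only [Nat.add_sub_cancel, risingFactorial]
  rw [mul_div_mul_comm, mul_assoc]
  have h1 : θ + 1 + m ≠ 0 := by linarith
  have h1' : θ + ((m+1:ℕ):ℝ) ≠ 0 := by push_cast; linarith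
  have h2 : α + θ - i + 1 + m ≠ 0 := by linarith
  have : (θ + 1 + m) / (α + θ - i + 1 + m) * (1 - ((i:ℝ) - α) / (θ + (m+1:ℕ))) = 1 := by
    field_simp
    push_cast
    ring
  rw [this, mul_one]

lemma dM (hα1 : α < 1) (hθ : 0 < α + θ) (hEP : IsEwensPitman α θ μ F K B)
    (i N : ℕ) (hi : 1 ≤ i) (hN : i + 1 ≤ N) : ∀ᵐ ω ∂μ, ∀ k, i + 1 ≤ k →
    Mmart α θ K B i (k+1) ω - Mmart α θ K B i k ω =
      aCoef α θ i (k+1) * (∑ r ∈ Finset.range N, ucf α i r * ee K B r k ω + gS α θ K B i k ω) := by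
  filter_upwards [dS hα1 hθ hEP i N hi hN] with ω h k hk
  rw [Mmart, Mmart, aCoef_step hα1 hθ i k hi hk, h k (by omega), gS]
  ring

lemma gS_sm (hEP : IsEwensPitman α θ μ F K B) (i k : ℕ) :
    StronglyMeasurable[F k] (gS α θ K B i k) := by
  unfold gS Sproc
  refine StronglyMeasurable.mul stronglyMeasurable_const (StronglyMeasurable.add
    (StronglyMeasurable.add ?_ ?_) stronglyMeasurable_const)
  · exact Finset.stronglyMeasurable_fun_sum _ fun r _ =>
      stronglyMeasurable_const.mul (B_sm hEP r k fun x => (x:ℝ))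
  · exact stronglyMeasurable_const.mul (K_sm hEP k fun x => (x:ℝ))

lemma mlp_add {f g : Ω → ℝ} (hf : MemLp f ⊤ μ) (hg : MemLp g ⊤ μ) :
    MemLp (fun ω => f ω + g ω) ⊤ μ := hf.add hg

lemma mlp_mul {f g : Ω → ℝ} (hf : MemLp f ⊤ μ) (hg : MemLp g ⊤ μ) :
    MemLp (fun ω => f ω * g ω) ⊤ μ := MemLp.mul (r := ⊤) hg hf

lemma mlp_cmul {f : Ω → ℝ} (c : ℝ) (hf : MemLp f ⊤ μ) :
    MemLp (fun ω => c * f ω) ⊤ μ := hf.const_mul c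

lemma gS_mem (hEP : IsEwensPitman α θ μ F K B) (i k : ℕ) (hk : 1 ≤ k) :
    MemLp (gS α θ K B i k) ⊤ μ := by
  have := hEP.prob
  unfold gS Sproc
  refine mlp_cmul _ (mlp_add (mlp_add ?_ ?_) (memLp_const _))
  · refine memLp_finsetSum _ fun r hr => mlp_cmul _ ?_
    refine memLp_top_of_bound ((B_sm hEP r k fun x => (x:ℝ)).mono (F.le _)).aestronglyMeasurable k ?_
    filter_upwards [ae_basic hEP] with ω h
    obtain ⟨_, _, ⟨_, h1⟩, h2, _⟩ := h k hk
    have := (h2 r (Finset.mem_Icc.1 hr).1).trans h1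
    simpa using this
  · refine mlp_cmul _ ?_
    refine memLp_top_of_bound ((K_sm hEP k fun x => (x:ℝ)).mono (F.le _)).aestronglyMeasurable k ?_
    filter_upwards [ae_basic hEP] with ω h
    obtain ⟨_, _, ⟨_, h1⟩, h2, _⟩ := h k hk
    simpa using h1

lemma qv (hα1 : α < 1) (hθ : 0 < α + θ) (hEP : IsEwensPitman α θ μ F K B)
    (i j N k : ℕ) (hi : 1 ≤ i) (hj : 1 ≤ j) (hiN : i + 1 ≤ N) (hjN : j + 1 ≤ N) (hk : N ≤ k) :
    μ[fun ω' => (Mmart α θ K B i (k + 1) ω' - Mmart α θ K B i k ω') *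
                (Mmart α θ K B j (k + 1) ω' - Mmart α θ K B j k ω') | F k] =ᵐ[μ]
    fun ω => ∑ r ∈ Finset.range N, aCoef α θ i (k+1) * aCoef α θ j (k+1) *
      (ucf α i r * ucf α j r + ucf α i r * gS α θ K B j k ω + ucf α j r * gS α θ K B i k ω)
        * pp α θ K B r k ω + aCoef α θ i (k+1) * aCoef α θ j (k+1) *
        (gS α θ K B i k ω * gS α θ K B j k ω) := by
  have := hEP.prob
  have hk1 : 1 ≤ k := by omega
  have mi := gS_sm hEP i k
  have mj := gS_sm hEP j k
  have bi := gS_mem hEP i k hk1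
  have bj := gS_mem hEP j k hk1
  refine (condExp_congr_ae ?_).trans (cond_quad hEP k hk1 N
    (fun r ω => aCoef α θ i (k+1) * aCoef α θ j (k+1) *
      (ucf α i r * ucf α j r + ucf α i r * gS α θ K B j k ω + ucf α j r * gS α θ K B i k ω))
    (fun ω => aCoef α θ i (k+1) * aCoef α θ j (k+1) *
        (gS α θ K B i k ω * gS α θ K B j k ω)) ?_ ?_ ?_ ?_)
  · filter_upwards [dM hα1 hθ hEP i N hi hiN, dM hα1 hθ hEP j N hj hjN] with ω h1 h2
    rw [h1 k (by omega), h2 k (by omega)]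
    have h3 := prod_ee (K := K) (B := B) (ucf α i) (ucf α j) N k ω
    have e : ∑ r ∈ Finset.range N, aCoef α θ i (k+1) * aCoef α θ j (k+1) *
      (ucf α i r * ucf α j r + ucf α i r * gS α θ K B j k ω + ucf α j r * gS α θ K B i k ω)
        * ee K B r k ω = aCoef α θ i (k+1) * aCoef α θ j (k+1) *
        (∑ r ∈ Finset.range N, ucf α i r * ucf α j r * ee K B r k ω +
        gS α θ K B j k ω * ∑ r ∈ Finset.range N, ucf α i r * ee K B r k ω +
        gS α θ K B i k ω * ∑ r ∈ Finset.range N, ucf α j r * ee K B r k ω) := by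
      rw [Finset.mul_sum, Finset.mul_sum, ← Finset.sum_add_distrib, ← Finset.sum_add_distrib,
        Finset.mul_sum]
      exact Finset.sum_congr rfl fun r _ => by ring
    rw [e, ← h3]
    ring
  · intro r
    exact stronglyMeasurable_const.mul ((stronglyMeasurable_const.add
      (stronglyMeasurable_const.mul mj)).add (stronglyMeasurable_const.mul mi))
  · exact stronglyMeasurable_const.mul (mi.mul mj)
  · intro r
    exact mlp_cmul _ (mlp_add (mlp_add (memLp_const _) (mlp_cmul _ bj)) (mlp_cmul _ bi))
  · exact mlp_cmul _ (mlp_mul bi bj)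

lemma gS_lim {ω : Ω} (hα0 : 0 < α) (i : ℕ)
    (h : ∃ L, Tendsto (fun n : ℕ => Sproc α K B i n ω / (n:ℝ) ^ α) atTop (𝓝 L)) :
    ∃ L, Tendsto (fun n : ℕ => gS α θ K B i n ω * (n:ℝ) ^ (1-α)) atTop (𝓝 L) := by
  obtain ⟨L, hL⟩ := h
  refine ⟨_, (((tendsto_shift_ratio 0 θ).const_mul ((i:ℝ)-α)).mul
    (hL.add ((nneg_lim hα0).const_mul ((-1 : ℝ) ^ i * sibuya α i * θ / α)))).congr' ?_⟩
  filter_upwards [eventually_ge_atTop 1, ev_pos θ] with n hn hn2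
  have hn' : (0:ℝ) < n := by exact_mod_cast hn
  have h2 := Real.rpow_pos_of_pos hn' α
  rw [Real.rpow_neg hn'.le, Real.rpow_sub hn', Real.rpow_one, gS, zero_add]
  field_simp

lemma gS_zero {ω : Ω} (hα1 : α < 1) (i : ℕ)
    (h : ∃ L, Tendsto (fun n : ℕ => gS α θ K B i n ω * (n:ℝ) ^ (1-α)) atTop (𝓝 L)) :
    Tendsto (fun n : ℕ => gS α θ K B i n ω) atTop (𝓝 0) := by
  obtain ⟨L, hL⟩ := h
  have := hL.mul (nneg_lim (sub_pos.2 hα1))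
  rw [mul_zero] at this
  refine this.congr' ?_
  filter_upwards [eventually_ge_atTop 1] with n hn
  have hn' : (0:ℝ) < n := by exact_mod_cast hn
  rw [mul_assoc, ← Real.rpow_add hn', add_neg_cancel, Real.rpow_zero, mul_one]

lemma aCoef_lim (hα1 : α < 1) (hθ : 0 < α + θ) (i : ℕ) :
    Tendsto (fun k : ℕ => aCoef α θ i (k+1) * (k:ℝ) ^ (α - i)) atTop
      (𝓝 (Real.Gamma (α + θ - i + 1) / Real.Gamma (θ + 1))) := by
  have h := rf_ratio (α + θ - i + 1) (θ + 1) (by linarith)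
  rw [show α + θ - i + 1 - (θ + 1) = α - i by ring] at h
  refine h.congr' ?_
  filter_upwards [eventually_ge_atTop i] with k hk
  rw [aCoef, if_neg (by omega), Nat.add_sub_cancel]

end


/-- With `V_n = n^(α/2) diag(n⁻¹, …, n⁻ᵈ)` and `⟨M⟩_n` the predictable quadratic variation
of the `d`-dimensional martingale `(M_{1,n}, …, M_{d,n})ᵀ`, there is a positive random
variable `S_{α,θ}` with `K_n/n^α → S_{α,θ}` a.s. and `V_n ⟨M⟩_n V_n → S_{α,θ} Σ_d` a.s.
(entrywise: the `(i,j)` entry of `V_n ⟨M⟩_n V_n` is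
`n^α n^{-(i+1)} n^{-(j+1)} ⟨M⟩_n(i,j)` for `i, j : Fin d`). -/
theorem matrix_qv_limit (α θ : ℝ) (hα0 : 0 < α) (hα1 : α < 1) (hθ : 0 < α + θ)
    {Ω : Type*} [mΩ : MeasurableSpace Ω] (μ : Measure Ω) (F : Filtration ℕ mΩ)
    (K : ℕ → Ω → ℕ) (B : ℕ → ℕ → Ω → ℕ) (hEP : IsEwensPitman α θ μ F K B)
    (d : ℕ) (hd : 1 ≤ d) :
    ∃ S : Ω → ℝ,
      (∀ᵐ ω ∂μ, 0 < S ω ∧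
        Tendsto (fun n => (K n ω : ℝ) / (n : ℝ) ^ α) atTop (𝓝 (S ω))) ∧
      ∀ i j : Fin d, ∀ᵐ ω ∂μ,
        Tendsto
          (fun n : ℕ =>
            (n : ℝ) ^ α / ((n : ℝ) ^ (i.val + 1) * (n : ℝ) ^ (j.val + 1)) *
              ∑ k ∈ Finset.Icc 1 (n - 1),
                (μ[fun ω' =>
                    (Mmart α θ K B (i.val + 1) (k + 1) ω' - Mmart α θ K B (i.val + 1) k ω') *
                    (Mmart α θ K B (j.val + 1) (k + 1) ω' - Mmart α θ K B (j.val + 1) k ω')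
                  | F k]) ω)
          atTop
          (𝓝 (S ω * sigmaEntry α θ (i.val + 1) (j.val + 1))) := by
  obtain ⟨S, hS⟩ := lims hα0 hα1 hθ hEP
  refine ⟨S, hS.mono fun ω h => h.1, fun i' j' => ?_⟩
  obtain ⟨i, hi⟩ : ∃ i, i = i'.val + 1 := ⟨_, rfl⟩
  obtain ⟨j, hj⟩ : ∃ j, j = j'.val + 1 := ⟨_, rfl⟩
  rw [← hi, ← hj]
  have hi1 : 1 ≤ i := by omega
  have hj1 : 1 ≤ j := by omega
  have hq0 := fun m : ℕ =>
    qv hα1 hθ hEP i j (i+j+1) (i+j+1+m) hi1 hj1 (by omega) (by omega) (by omega)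
  unfold Filter.EventuallyEq at hq0
  have hq := ae_all_iff.2 hq0
  filter_upwards [hS, hq] with ω ⟨⟨hS0, _⟩, hpp, hSp⟩ hω
  set t : ℕ → ℝ := fun k => (μ[fun ω' => (Mmart α θ K B i (k + 1) ω' - Mmart α θ K B i k ω') *
      (Mmart α θ K B j (k + 1) ω' - Mmart α θ K B j k ω') | F k]) ω with ht
  have hij : (2:ℝ) ≤ (i + j : ℕ) := by exact_mod_cast (by omega : 2 ≤ i + j)
  have hp : 0 < ((i+j:ℕ):ℝ) - α := by linarith
  have gi := gS_lim (θ := θ) hα0 i (hSp i)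
  have gj := gS_lim (θ := θ) hα0 j (hSp j)
  have zi := gS_zero hα1 i gi
  have zj := gS_zero hα1 j gj
  obtain ⟨Gi, gi⟩ := gi
  set A := Real.Gamma (α + θ - i + 1) / Real.Gamma (θ + 1) with hA
  set A' := Real.Gamma (α + θ - j + 1) / Real.Gamma (θ + 1) with hA'
  have hsum : Tendsto (fun k : ℕ => ∑ r ∈ Finset.range (i+j+1),
      (ucf α i r * ucf α j r + ucf α i r * gS α θ K B j k ω + ucf α j r * gS α θ K B i k ω)
        * (pp α θ K B r k ω * (k:ℝ)^(1-α))) atTop (𝓝 (∑ r ∈ Finset.range (i+j+1),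
      (ucf α i r * ucf α j r + ucf α i r * 0 + ucf α j r * 0) * (wcf α r * S ω))) :=
    tendsto_finsetSum _ fun r _ => ((tendsto_const_nhds.add (zj.const_mul _)).add
      (zi.const_mul _)).mul (hpp r)
  have hlim := ((aCoef_lim hα1 hθ i).mul (aCoef_lim hα1 hθ j)).mul (hsum.add (gi.mul zj))
  have e1 : ∑ r ∈ Finset.range (i+j+1),
      (ucf α i r * ucf α j r + ucf α i r * 0 + ucf α j r * 0) * (wcf α r * S ω) =
      (((i+j:ℕ):ℝ) - α) * ((-1) ^ (i + j) * ((i + j).factorial:ℝ) / ((i.factorial:ℝ) * (j.factorial:ℝ)) * sibuya α (i + j)) * S ω := by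
    rw [← uuw α i j hi1 (i+j+1) (by omega), Finset.sum_mul]
    exact Finset.sum_congr rfl fun r _ => by ring
  rw [e1] at hlim
  have ht2 := hlim.congr' (f₂ := fun k : ℕ => t k * (k:ℝ) ^ (1 - (((i+j:ℕ):ℝ) - α))) (by
    filter_upwards [eventually_ge_atTop (i+j+1)] with k hk
    have hk' : (0:ℝ) < k := by exact_mod_cast (by omega : 0 < k)
    have e2 : (k:ℝ) ^ (1 - (((i+j:ℕ):ℝ) - α)) = (k:ℝ)^(α - i) * (k:ℝ)^(α-j) * (k:ℝ)^(1-α) := by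
      rw [← Real.rpow_add hk', ← Real.rpow_add hk']; congr 1; push_cast; ring
    rw [e2]
    have := hω (k - (i+j+1))
    rw [show i+j+1 + (k - (i+j+1)) = k by omega] at this
    simp only [ht]
    rw [this]
    have e3 : ∑ r ∈ Finset.range (i+j+1), aCoef α θ i (k+1) * aCoef α θ j (k+1) *
      (ucf α i r * ucf α j r + ucf α i r * gS α θ K B j k ω + ucf α j r * gS α θ K B i k ω)
        * pp α θ K B r k ω = aCoef α θ i (k+1) * aCoef α θ j (k+1) *
        ∑ r ∈ Finset.range (i+j+1), (ucf α i r * ucf α j r + ucf α i r * gS α θ K B j k ω +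
          ucf α j r * gS α θ K B i k ω) * pp α θ K B r k ω := by
      rw [Finset.mul_sum]
      exact Finset.sum_congr rfl fun r _ => by ring
    rw [e3]
    simp only [← mul_assoc, ← Finset.sum_mul]
    ring)
  have hfin := sum_asymp t _ _ hp ht2
  have e4 : A * A' * ((((i+j:ℕ):ℝ) - α) * ((-1) ^ (i + j) * ((i + j).factorial:ℝ) /
      ((i.factorial:ℝ) * (j.factorial:ℝ)) * sibuya α (i + j)) * S ω + Gi * 0) / (((i+j:ℕ):ℝ) - α) =
      S ω * sigmaEntry α θ i j := by
    rw [sigmaEntry, hA, hA', mul_zero, add_zero, div_eq_iff hp.ne']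
    ring
  rw [e4] at hfin
  refine hfin.congr' ?_
  filter_upwards [eventually_ge_atTop 1] with n hn
  have hn' : (0:ℝ) < n := by exact_mod_cast hn
  congr 1
  rw [neg_sub, Real.rpow_sub hn', Real.rpow_natCast, pow_add]

end
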